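/- Let p, q be integers with p > 1 and q > 1. Let G = SL(p+q, ℝ), let J = diag(I_p, -I_q), and let H = {A ∈ G : Aᵀ J A = J} (the indefinite special orthogonal group SO(p,q)). Then there is no discrete subgroup Γ of G acting properly discontinuously and cocompactly on the homogeneous space G/H; that is, SL(p+q,ℝ)/SO(p,q) admits no compact Clifford–Klein form. -/

import Mathlib

/-!
The homogeneous space `SL(p+q,ℝ)/SO(p,q)` (`p, q > 1`) admits no compact
Clifford–Klein form.
-/

open Matrix

set_option maxHeartbeats 1000000
set_option synthInstance.maxHeartbeats 1000000

noncomputable section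

/-- The special linear group `SL(p+q, ℝ)`, realized as the subgroup of `GL(p+q, ℝ)` of
matrices of determinant `1`; here `ℝ^{p+q}` is indexed by `Fin p ⊕ Fin q`. -/
def SLpq (p q : ℕ) : Subgroup (GL (Fin p ⊕ Fin q) ℝ) where
  carrier := {A | A.val.det = 1}
  one_mem' := by simp
  mul_mem' := by
    intro A B hA hB
    show (A * B).val.det = 1
    rw [Units.val_mul, det_mul, hA, hB, mul_one]
  inv_mem' := by
    intro A hA
    show (A⁻¹).val.det = 1
    have h := congrArg Matrix.det (Units.mul_inv A)
    rw [det_mul, hA, one_mul] at h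
    simpa using h

/-- The matrix `J = diag(I_p, -I_q)`. -/
def Jpq (p q : ℕ) : Matrix (Fin p ⊕ Fin q) (Fin p ⊕ Fin q) ℝ :=
  Matrix.diagonal (Sum.elim (fun _ => 1) (fun _ => -1))

/-- The indefinite special orthogonal group `SO(p,q)`, realized as the subgroup of
`SL(p+q,ℝ)` of matrices `A` with `Aᵀ J A = J`, where `J = diag(I_p, -I_q)`. -/
def SOpqInSL (p q : ℕ) : Subgroup ↥(SLpq p q) where
  carrier := {A | A.val.valᵀ * Jpq p q * A.val.val = Jpq p q}
  one_mem' := by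
    show (1 : Matrix (Fin p ⊕ Fin q) (Fin p ⊕ Fin q) ℝ)ᵀ * Jpq p q * 1 = Jpq p q
    simp
  mul_mem' := by
    intro A B hA hB
    show (A * B).val.valᵀ * Jpq p q * (A * B).val.val = Jpq p q
    have h : (A * B).val.val = A.val.val * B.val.val := rfl
    have key : (A.val.val * B.val.val)ᵀ * Jpq p q * (A.val.val * B.val.val) =
        B.val.valᵀ * (A.val.valᵀ * Jpq p q * A.val.val) * B.val.val := by
      rw [transpose_mul]
      simp only [Matrix.mul_assoc]
    rw [h, key, hA]
    exact hB
  inv_mem' := by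
    intro A hA
    show (A⁻¹).val.valᵀ * Jpq p q * (A⁻¹).val.val = Jpq p q
    have hAinv : A.val.val * (A⁻¹).val.val = 1 := by
      have h : (A⁻¹).val = (A.val)⁻¹ := rfl
      rw [h]; exact Units.mul_inv A.val
    calc (A⁻¹).val.valᵀ * Jpq p q * (A⁻¹).val.val
        = (A⁻¹).val.valᵀ * (A.val.valᵀ * Jpq p q * A.val.val) * (A⁻¹).val.val := by rw [hA]
      _ = (A.val.val * (A⁻¹).val.val)ᵀ * Jpq p q * (A.val.val * (A⁻¹).val.val) := by
          rw [transpose_mul]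
          simp only [Matrix.mul_assoc]
      _ = Jpq p q := by rw [hAinv]; simp

section Piola

variable {ι : Type*} [Fintype ι] [DecidableEq ι]

/-- The determinant, as a continuous real-multilinear function of the rows of a complex matrix. -/
def rowDet (ι : Type*) [Fintype ι] [DecidableEq ι] :
    ContinuousMultilinearMap ℝ (fun _ : ι => ι → ℂ) ℂ where
  toMultilinearMap :=
    (detRowAlternating (R := ℂ) (n := ι)).toMultilinearMap.restrictScalars ℝ
  cont := by
    have h : Continuous fun M : ι → ι → ℂ => (Matrix.of M).det :=
      Continuous.matrix_det continuous_id
    exact h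

lemma rowDet_apply (g : ι → ι → ℂ) : rowDet ι g = (Matrix.of g).det := rfl

lemma rowDet_swap (g : ι → ι → ℂ) {i j : ι} (h : i ≠ j) (u v : ι → ℂ) :
    rowDet ι (Function.update (Function.update g i u) j v) =
      - rowDet ι (Function.update (Function.update g j u) i v) := by
  have h1 := (detRowAlternating (R := ℂ) (n := ι)).map_swap
    (Function.update (Function.update g j u) i v) h
  have h2 : (Function.update (Function.update g j u) i v) ∘ Equiv.swap i j =
      Function.update (Function.update g i u) j v := by
    funext k
    by_cases hi : k = i
    · subst hi
      simp [h, h.symm]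
    · by_cases hj : k = j
      · subst hj; simp
      · simp [Equiv.swap_apply_of_ne_of_ne hi hj, hi, hj]
  rw [h2] at h1
  exact h1

/-- Cramer's rule, applied to a linear form. -/
lemma sum_linear_mul_rowDet_update (g : ι → ι → ℂ) (v : ι → ℂ) (α : (ι → ℂ) →ₗ[ℂ] ℂ) :
    ∑ j, α (g j) * rowDet ι (Function.update g j v) = α v * rowDet ι g := by
  have h := Matrix.mulVec_cramer (Matrix.of g)ᵀ v
  have h2 : ∑ j, (rowDet ι (Function.update g j v)) • g j = (rowDet ι g) • v := by
    rw [Matrix.det_transpose] at h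
    rw [rowDet_apply, ← h]
    funext i
    simp only [Finset.sum_apply, Pi.smul_apply, smul_eq_mul, Matrix.mulVec, dotProduct]
    refine Finset.sum_congr rfl fun j _ => ?_
    rw [Matrix.cramer_transpose_apply, mul_comm]
    rfl
  have h3 := congrArg α h2
  simp only [map_sum, map_smul, smul_eq_mul] at h3
  rw [mul_comm (α v), ← h3]
  exact Finset.sum_congr rfl fun j _ => mul_comm _ _

variable {Z : Type*} [NormedAddCommGroup Z] [NormedSpace ℝ Z]

/-- A Piola-type identity: `w · det (∂f)` is, in the direction `τ`, the divergence of the vector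
field obtained by replacing one row of `∂f` by `∂_τ f`, if `dw` is a complex-linear function
of `df`. -/
lemma fderiv_mul_rowDet {f : Z → ι → ℂ} {w : Z → ℂ} {z : Z} (hf : ContDiffAt ℝ 2 f z)
    (α : (ι → ℂ) →ₗ[ℂ] ℂ) (hw : DifferentiableAt ℝ w z)
    (hα : ∀ v, fderiv ℝ w z v = α (fderiv ℝ f z v)) (b : ι → Z) (τ : Z) :
    fderiv ℝ (fun y => w y * rowDet ι (fun i => fderiv ℝ f y (b i))) z τ =
      ∑ j, fderiv ℝ (fun y => w y * rowDet ι
        (Function.update (fun i => fderiv ℝ f y (b i)) j (fderiv ℝ f y τ))) z (b j) := by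
  set B := fderiv ℝ (fderiv ℝ f) z with hB
  have hsymm : ∀ u v, B u v = B v u := fun u v =>
    (hf.isSymmSndFDerivAt (by simp)).eq u v
  have hd : HasFDerivAt (fderiv ℝ f) B z :=
    ((hf.fderiv_right (m := 1) (by norm_num)).differentiableAt (by norm_num)).hasFDerivAt
  have hdv : ∀ v, HasFDerivAt (fun y => fderiv ℝ f y v) (B.flip v) z := fun v => by
    have := hd.clm_apply (hasFDerivAt_const v z)
    simpa using this
  set g : ι → ι → ℂ := fun i => fderiv ℝ f z (b i) with hg
  set u := fderiv ℝ f z τ with hu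
  have h1 : fderiv ℝ (fun y => w y * rowDet ι (fun i => fderiv ℝ f y (b i))) z τ =
      α u * rowDet ι g + w z * ∑ i, rowDet ι (Function.update g i (B τ (b i))) := by
    have := hw.hasFDerivAt.fun_mul
      (HasFDerivAt.multilinear_comp (rowDet ι) (fun i => hdv (b i)))
    rw [this.fderiv]
    simp [hα, hg, hu]
    ring
  have h2 : ∀ j, fderiv ℝ (fun y => w y * rowDet ι
        (Function.update (fun i => fderiv ℝ f y (b i)) j (fderiv ℝ f y τ))) z (b j) =
      α (g j) * rowDet ι (Function.update g j u) + w z * ∑ i,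
        if i = j then rowDet ι (Function.update g j (B τ (b j))) else
          rowDet ι (Function.update (Function.update g j u) i (B (b j) (b i))) := by
    intro j
    have h3 : ∀ i, HasFDerivAt (fun y =>
        Function.update (fun i => fderiv ℝ f y (b i)) j (fderiv ℝ f y τ) i)
        (if i = j then B.flip τ else B.flip (b i)) z := by
      intro i
      by_cases hij : i = j
      · subst hij; simpa using hdv τ
      · simpa [hij] using hdv (b i)
    have := hw.hasFDerivAt.fun_mul (HasFDerivAt.multilinear_comp (rowDet ι) h3)
    rw [this.fderiv]
    simp only [_root_.add_apply, _root_.smul_apply, _root_.sum_apply,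
      ContinuousLinearMap.comp_apply, smul_eq_mul, hα]
    rw [add_comm, mul_comm]
    congr 2
    refine Finset.sum_congr rfl fun i _ => ?_
    by_cases hij : i = j
    · subst hij
      simp [hsymm (b i) τ, hg]
    · simp [hij, hg, hu]
  rw [h1, Finset.sum_congr rfl fun j _ => h2 j, Finset.sum_add_distrib,
    sum_linear_mul_rowDet_update, ← Finset.mul_sum]
  congr 2
  have h4 : ∀ j, (∑ i, if i = j then rowDet ι (Function.update g j (B τ (b j))) else
          rowDet ι (Function.update (Function.update g j u) i (B (b j) (b i)))) =
      rowDet ι (Function.update g j (B τ (b j))) + ∑ i, if i = j then 0 else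
          rowDet ι (Function.update (Function.update g j u) i (B (b j) (b i))) := by
    intro j
    rw [← Finset.add_sum_erase _ _ (Finset.mem_univ j),
      ← Finset.add_sum_erase (a := j) Finset.univ (fun i => if i = j then (0 : ℂ) else
          rowDet ι (Function.update (Function.update g j u) i (B (b j) (b i)))) (Finset.mem_univ j)]
    simp only [if_true, zero_add]
    congr 1
    refine Finset.sum_congr rfl fun i hi => ?_
    simp [Finset.ne_of_mem_erase hi]
  rw [Finset.sum_congr rfl fun j _ => h4 j, Finset.sum_add_distrib, left_eq_add]
  have h5 : (∑ j, ∑ i, if i = j then (0 : ℂ) else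
          rowDet ι (Function.update (Function.update g j u) i (B (b j) (b i)))) =
      - ∑ j, ∑ i, if i = j then (0 : ℂ) else
          rowDet ι (Function.update (Function.update g j u) i (B (b j) (b i))) := by
    conv_lhs => rw [Finset.sum_comm]
    rw [← Finset.sum_neg_distrib]
    refine Finset.sum_congr rfl fun j _ => ?_
    rw [← Finset.sum_neg_distrib]
    refine Finset.sum_congr rfl fun i _ => ?_
    by_cases hij : i = j
    · simp [hij]
    · simp only [hij, Ne.symm hij, if_false]
      rw [rowDet_swap g hij, hsymm]
  exact self_eq_neg.mp h5

end Piola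

section Stokes

open MeasureTheory Topology

/-- A function that is continuous on an open set, multiplied by a continuous function supported
in this set, is continuous. -/
lemma continuous_smul_of_tsupport {X : Type*} [TopologicalSpace X] {φ : X → ℝ} {h : X → ℂ}
    (hφ : Continuous φ) (hh : ∀ x ∈ tsupport φ, ContinuousAt h x) :
    Continuous fun x => φ x • h x := by
  refine continuous_of_tsupport fun x hx => ?_
  exact hφ.continuousAt.smul (hh x (tsupport_smul_subset_left φ h hx))

variable {ι : Type*} [Fintype ι] [DecidableEq ι]

/-- The density obtained by pulling back `w dz₁ ∧ ⋯ ∧ dz_D` by `f(t, ·)`. -/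
def pullbackDensity (f : ℝ × (ι → ℝ) → ι → ℂ) (w : ℝ × (ι → ℝ) → ℂ) (z : ℝ × (ι → ℝ)) : ℂ :=
  w z * rowDet ι (fun i => fderiv ℝ f z (0, Pi.single i 1))

/-- The vector field whose divergence is the time derivative of `pullbackDensity`. -/
def transgression (f : ℝ × (ι → ℝ) → ι → ℂ) (w : ℝ × (ι → ℝ) → ℂ) (j : ι)
    (z : ℝ × (ι → ℝ)) : ℂ :=
  w z * rowDet ι (Function.update (fun i => fderiv ℝ f z (0, Pi.single i 1)) j
    (fderiv ℝ f z (1, 0)))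

variable {f : ℝ × (ι → ℝ) → ι → ℂ} {w : ℝ × (ι → ℝ) → ℂ}

lemma contDiffAt_pullbackDensity {z : ℝ × (ι → ℝ)} (hf : ContDiffAt ℝ 2 f z)
    (hw : ContDiffAt ℝ 1 w z) : ContDiffAt ℝ 1 (pullbackDensity f w) z := by
  refine hw.mul ((rowDet ι).contDiff.contDiffAt.comp z (contDiffAt_pi.2 fun i => ?_))
  exact (hf.fderiv_right (m := 1) (by norm_num)).clm_apply contDiffAt_const

lemma contDiffAt_transgression {z : ℝ × (ι → ℝ)} (hf : ContDiffAt ℝ 2 f z)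
    (hw : ContDiffAt ℝ 1 w z) (j : ι) : ContDiffAt ℝ 1 (transgression f w j) z := by
  refine hw.mul ((rowDet ι).contDiff.contDiffAt.comp z (contDiffAt_pi.2 fun i => ?_))
  have h : ∀ v, ContDiffAt ℝ 1 (fun y => fderiv ℝ f y v) z := fun v =>
    (hf.fderiv_right (m := 1) (by norm_num)).clm_apply contDiffAt_const
  by_cases hij : i = j
  · subst hij; simpa using h (1, 0)
  · simpa [hij] using h (0, Pi.single i 1)

variable {C : Set (ι → ℝ)} {φ : (ι → ℝ) → ℝ}

/-- Homotopy invariance of the integral of a pulled back top-degree holomorphic form, weighted by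
a cutoff function. -/
lemma integral_pullbackDensity_homotopy
    (hf : ∀ z : ℝ × (ι → ℝ), z.2 ∈ C → ContDiffAt ℝ 2 f z)
    (hw : ∀ z : ℝ × (ι → ℝ), z.2 ∈ C → ContDiffAt ℝ 1 w z)
    (hα : ∀ z : ℝ × (ι → ℝ), z.2 ∈ C → ∃ α : (ι → ℂ) →ₗ[ℂ] ℂ,
      ∀ v, fderiv ℝ w z v = α (fderiv ℝ f z v))
    (hφ : ContDiff ℝ 1 φ) (hφc : HasCompactSupport φ) (hφC : tsupport φ ⊆ C)
    (hY : ∀ t ∈ Set.Icc (0 : ℝ) 1,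
      ∫ x, ∑ j, fderiv ℝ φ x (Pi.single j 1) • transgression f w j (t, x) = 0) :
    ∫ x, φ x • pullbackDensity f w (1, x) = ∫ x, φ x • pullbackDensity f w (0, x) := by
  set a := pullbackDensity f w with ha
  have haC : ∀ z : ℝ × (ι → ℝ), z.2 ∈ C → ContDiffAt ℝ 1 a z := fun z hz =>
    contDiffAt_pullbackDensity (hf z hz) (hw z hz)
  have hYC : ∀ j, ∀ z : ℝ × (ι → ℝ), z.2 ∈ C → ContDiffAt ℝ 1 (transgression f w j) z :=
    fun j z hz => contDiffAt_transgression (hf z hz) (hw z hz) j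
  have hsub : ∀ x, x ∈ tsupport φ → x ∈ C := fun x hx => hφC hx
  have hcs : ∀ h : (ι → ℝ) → ℂ, HasCompactSupport fun x => φ x • h x := fun h => hφc.smul_right
  -- the slice derivatives
  have hslice : ∀ (t : ℝ) (x : ι → ℝ), HasFDerivAt (fun y : ι → ℝ => (t, y))
      (ContinuousLinearMap.inr ℝ ℝ (ι → ℝ)) x := fun t x => hasFDerivAt_prodMk_right t x
  have hYslice : ∀ j t x, x ∈ C → HasFDerivAt (fun y => transgression f w j (t, y))
      ((fderiv ℝ (transgression f w j) (t, x)).comp (ContinuousLinearMap.inr ℝ ℝ (ι → ℝ))) x :=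
    fun j t x hx => ((((hYC j (t, x) hx).differentiableAt (by norm_num)).hasFDerivAt).comp x
      (hslice t x))
  set G : ℝ × (ι → ℝ) → ℂ := fun z => φ z.2 • fderiv ℝ a z (1, 0) with hG
  have hts : ∀ z : ℝ × (ι → ℝ), z ∈ tsupport (fun z : ℝ × (ι → ℝ) => φ z.2) → z.2 ∈ C := by
    intro z hz
    exact hφC (tsupport_comp_subset_preimage φ continuous_snd hz)
  have hGc : Continuous G := by
    refine continuous_smul_of_tsupport (φ := fun z : ℝ × (ι → ℝ) => φ z.2)
      (hφ.continuous.comp continuous_snd) fun z hz => ?_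
    exact (((haC z (hts z hz)).fderiv_right (m := 0) (by norm_num)).clm_apply
      contDiffAt_const).continuousAt
  have hint : ∀ s : ℝ, Integrable fun x => φ x • a (s, x) := fun s =>
    (continuous_smul_of_tsupport hφ.continuous fun x hx =>
      ((haC (s, x) (hsub x hx)).continuousAt.comp (by fun_prop))).integrable_of_hasCompactSupport
        (hcs _)
  -- spatial integrals of the time derivative vanish
  have hzero : ∀ t ∈ Set.Icc (0 : ℝ) 1, ∫ x, G (t, x) = 0 := by
    intro t ht
    have h1 : ∀ x, G (t, x) = ∑ j, φ x • fderiv ℝ (fun y => transgression f w j (t, y)) x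
        (Pi.single j 1) := by
      intro x
      by_cases hx : x ∈ C
      · obtain ⟨α, hα'⟩ := hα (t, x) hx
        have := fderiv_mul_rowDet (hf (t, x) hx) α
          ((hw (t, x) hx).differentiableAt (by norm_num)) hα'
          (fun i => ((0 : ℝ), (Pi.single i 1 : ι → ℝ))) (1, 0)
        rw [← Finset.smul_sum]
        simp only [hG]
        congr 1
        refine this.trans (Finset.sum_congr rfl fun j _ => ?_)
        rw [(hYslice j t x hx).fderiv]
        rfl
      · have : φ x = 0 := image_eq_zero_of_notMem_tsupport fun h => hx (hsub x h)
        simp [hG, this]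
    have hI1 : ∀ j, Integrable fun x =>
        fderiv ℝ φ x (Pi.single j 1) • transgression f w j (t, x) := by
      intro j
      have hd : Continuous fun x => fderiv ℝ φ x (Pi.single j 1) :=
        (hφ.continuous_fderiv (by norm_num)).clm_apply continuous_const
      have hs : tsupport (fun x => fderiv ℝ φ x (Pi.single j 1)) ⊆ tsupport φ :=
        tsupport_fderiv_apply_subset ℝ _
      refine (continuous_smul_of_tsupport hd fun x hx => ?_).integrable_of_hasCompactSupport
        (HasCompactSupport.smul_right (hφc.fderiv_apply ℝ _))
      exact ((hYC j (t, x) (hsub x (hs hx))).continuousAt.comp (by fun_prop))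
    have hI2 : ∀ j, Integrable fun x => φ x • fderiv ℝ (fun y => transgression f w j (t, y)) x
        (Pi.single j 1) := by
      intro j
      refine (continuous_smul_of_tsupport hφ.continuous fun x hx =>
        ?_).integrable_of_hasCompactSupport
        (hcs _)
      have hcd : ContDiffAt ℝ 1 (fun y => transgression f w j (t, y)) x :=
        (hYC j (t, x) (hsub x hx)).comp x (contDiffAt_const.prodMk contDiffAt_id)
      exact ((hcd.fderiv_right (m := 0) (by norm_num)).clm_apply contDiffAt_const).continuousAt
    have hI3 : ∀ j, Integrable fun x => φ x • transgression f w j (t, x) := by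
      intro j
      refine (continuous_smul_of_tsupport hφ.continuous fun x hx =>
        ?_).integrable_of_hasCompactSupport
        (hcs _)
      exact (hYC j (t, x) (hsub x hx)).continuousAt.comp (by fun_prop)
    simp_rw [h1]
    rw [integral_finsetSum _ fun j _ => hI2 j]
    have h2 : ∀ j, ∫ x, φ x • fderiv ℝ (fun y => transgression f w j (t, y)) x (Pi.single j 1) =
        - ∫ x, fderiv ℝ φ x (Pi.single j 1) • transgression f w j (t, x) := by
      intro j
      exact integral_smul_fderiv_eq_neg_fderiv_smul_of_integrable (hI1 j) (hI2 j) (hI3 j)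
        (fun x _ => (hφ.differentiable (by norm_num)) x)
        (fun x hx => (hYslice j t x (hsub x hx)).differentiableAt)
    rw [Finset.sum_congr rfl fun j _ => h2 j, Finset.sum_neg_distrib,
      ← integral_finsetSum _ fun j _ => hI1 j, hY t ht, neg_zero]
  -- the fundamental theorem of calculus in time
  have hftc : ∀ x, φ x • a (1, x) - φ x • a (0, x) = ∫ t in (0 : ℝ)..1, G (t, x) := by
    intro x
    by_cases hx : x ∈ C
    · symm
      have hd : ∀ t : ℝ, HasDerivAt (fun t : ℝ => φ x • a (t, x)) (G (t, x)) t := by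
        intro t
        have h1 : HasDerivAt (fun s : ℝ => (s, x)) ((1 : ℝ), (0 : ι → ℝ)) t :=
          (hasDerivAt_id t).prodMk (hasDerivAt_const t x)
        exact ((((haC (t, x) hx).differentiableAt (by norm_num)).hasFDerivAt).comp_hasDerivAt t
          h1).const_smul (φ x)
      exact intervalIntegral.integral_eq_sub_of_hasDerivAt (fun t _ => hd t)
        ((hGc.comp (by fun_prop)).intervalIntegrable _ _)
    · have : φ x = 0 := image_eq_zero_of_notMem_tsupport fun h => hx (hsub x h)
      simp [hG, this]
  rw [← sub_eq_zero, ← integral_sub (hint 1) (hint 0)]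
  simp_rw [hftc, intervalIntegral.integral_of_le zero_le_one]
  rw [integral_integral_swap]
  · exact setIntegral_eq_zero_of_forall_eq_zero fun t ht => hzero t (Set.Ioc_subset_Icc_self ht)
  · have h1 : IntegrableOn (fun z : (ι → ℝ) × ℝ => G (z.2, z.1))
        (tsupport φ ×ˢ Set.Icc (0 : ℝ) 1) (volume.prod volume) :=
      (hGc.comp (by fun_prop)).continuousOn.integrableOn_compact
        (hφc.isCompact.prod isCompact_Icc)
    have h2 : IntegrableOn (fun z : (ι → ℝ) × ℝ => G (z.2, z.1))
        (Set.univ ×ˢ Set.Ioc (0 : ℝ) 1) (volume.prod volume) := by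
      refine h1.of_forall_sdiff_eq_zero (MeasurableSet.univ.prod measurableSet_Ioc) ?_
      rintro ⟨x, t⟩ ⟨⟨-, ht⟩, hx⟩
      have : x ∉ tsupport φ := fun h => hx ⟨h, Set.Ioc_subset_Icc_self ht⟩
      simp [hG, image_eq_zero_of_notMem_tsupport this]
    rw [IntegrableOn, ← Measure.prod_restrict, Measure.restrict_univ] at h2
    exact h2

end Stokes

section Unfolding

open MeasureTheory Topology

variable {ι : Type*} [Fintype ι] [DecidableEq ι]

lemma sum_fderiv_comp_mulVec_smul {φ : (ι → ℝ) → ℝ} (A : Matrix ι ι ℝ) {y : ι → ℝ}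
    (hφ : DifferentiableAt ℝ φ (A *ᵥ y)) (v : ι → ℂ) :
    ∑ j, fderiv ℝ (fun x => φ (A *ᵥ x)) y (Pi.single j 1) • v j =
      ∑ k, fderiv ℝ φ (A *ᵥ y) (Pi.single k 1) • ∑ j, (A k j : ℂ) * v j := by
  have h1 : HasFDerivAt (fun x => φ (A *ᵥ x))
      ((fderiv ℝ φ (A *ᵥ y)).comp (LinearMap.toContinuousLinearMap A.mulVecLin)) y :=
    HasFDerivAt.comp y (g := φ) (f := fun x => A *ᵥ x) hφ.hasFDerivAt
      (LinearMap.toContinuousLinearMap A.mulVecLin).hasFDerivAt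
  have h2 : ∀ j, fderiv ℝ (fun x => φ (A *ᵥ x)) y (Pi.single j 1) =
      ∑ k, A k j * fderiv ℝ φ (A *ᵥ y) (Pi.single k 1) := by
    intro j
    rw [h1.fderiv]
    have h3 : A *ᵥ Pi.single j 1 = ∑ k, A k j • (Pi.single k 1 : ι → ℝ) := by
      rw [Matrix.mulVec_single_one]
      exact pi_eq_sum_univ' _
    simp [h3, map_sum]
  simp_rw [h2, Finset.sum_smul, Finset.smul_sum]
  rw [Finset.sum_comm]
  refine Finset.sum_congr rfl fun k _ => Finset.sum_congr rfl fun j _ => ?_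
  simp only [Complex.real_smul, Complex.ofReal_mul]
  ring

variable {Λ : Type*} [Group Λ] {ρ : Λ →* Matrix ι ι ℝ} {C : Set (ι → ℝ)} {φ : (ι → ℝ) → ℝ}
  {Y : (ι → ℝ) → ι → ℂ}

lemma mulVec_inv_mulVec (ρ : Λ →* Matrix ι ι ℝ) (l : Λ) (x : ι → ℝ) :
    ρ l *ᵥ (ρ l⁻¹ *ᵥ x) = x := by
  rw [mulVec_mulVec, ← map_mul, mul_inv_cancel, map_one, one_mulVec]

lemma inv_mulVec_mulVec (ρ : Λ →* Matrix ι ι ℝ) (l : Λ) (x : ι → ℝ) :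
    ρ l⁻¹ *ᵥ (ρ l *ᵥ x) = x := by
  rw [mulVec_mulVec, ← map_mul, inv_mul_cancel, map_one, one_mulVec]

lemma det_map_ne_zero (ρ : Λ →* Matrix ι ι ℝ) (l : Λ) : (ρ l).det ≠ 0 := by
  intro h
  have : (ρ l * ρ l⁻¹).det = 1 := by rw [← map_mul, mul_inv_cancel, map_one, det_one]
  rw [det_mul, h, zero_mul] at this
  exact zero_ne_one this

lemma integral_comp_mulVec {g : (ι → ℝ) → ℂ} {A : Matrix ι ι ℝ} (hA : A.det ≠ 0) :
    ∫ x, g (A *ᵥ x) = (|A.det|⁻¹ : ℝ) • ∫ x, g x := by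
  have h := Real.map_matrix_volume_pi_eq_smul_volume_pi hA
  have hemb : MeasurableEmbedding (Matrix.toLin' A) := by
    have hc : Continuous (Matrix.toLin' A) := LinearMap.continuous_of_finiteDimensional _
    refine hc.measurableEmbedding ?_
    have := Matrix.mulVec_injective_of_isUnit ((Matrix.isUnit_iff_isUnit_det A).2 hA.isUnit)
    exact this
  have h2 := hemb.integral_map (μ := volume) g
  rw [h, integral_smul_measure] at h2
  rw [ENNReal.toReal_ofReal (abs_nonneg _), abs_inv] at h2
  exact h2.symm

/-- The flux of an equivariant vector field density through a fundamental cutoff function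
vanishes. -/
lemma integral_flux_eq_zero
    (hprop : ∀ K ⊆ C, IsCompact K → {l | ∃ x ∈ K, ρ l *ᵥ x ∈ K}.Finite)
    (hφ : ContDiff ℝ 1 φ) (hφc : HasCompactSupport φ) (hφC : tsupport φ ⊆ C)
    (hsum : ∀ x ∈ C, ∑ᶠ l, φ (ρ l *ᵥ x) = 1)
    (hYc : ∀ x ∈ C, ContinuousAt Y x)
    (hY : ∀ l, ∀ x ∈ C, ∀ j, |(ρ l).det| • Y (ρ l *ᵥ x) j = ∑ k, (ρ l j k : ℂ) * Y x k) :
    ∫ x, ∑ j, fderiv ℝ φ x (Pi.single j 1) • Y x j = 0 := by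
  have hF := hprop _ hφC hφc
  set F := hF.toFinset with hFdef
  have hmem : ∀ l x, x ∈ tsupport φ → ρ l *ᵥ x ∈ tsupport φ → l ∈ F := fun l x h1 h2 => by
    rw [hFdef, Set.Finite.mem_toFinset]; exact ⟨x, h1, h2⟩
  have hsupp : ∀ x, φ x ≠ 0 → x ∈ tsupport φ := fun x hx => subset_tsupport φ hx
  have hsum' : ∀ x ∈ tsupport φ, ∑ l ∈ F, φ (ρ l *ᵥ x) = 1 := by
    intro x hx
    rw [← hsum x (hφC hx)]
    refine (finsum_eq_sum_of_support_subset _ fun l hl => ?_).symm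
    exact hmem l x hx (hsupp _ hl)
  have hsum2 : ∀ x ∈ tsupport φ, ∑ l ∈ F, φ (ρ l⁻¹ *ᵥ x) = 1 := by
    intro x hx
    rw [← hsum x (hφC hx), ← finsum_comp_equiv (Equiv.inv Λ)]
    refine (finsum_eq_sum_of_support_subset _ fun l hl => ?_).symm
    have hl' : ρ l⁻¹ *ᵥ x ∈ tsupport φ := hsupp _ hl
    refine hmem l _ hl' ?_
    rwa [mulVec_inv_mulVec]
  have hmc : ∀ l, Continuous fun x : ι → ℝ => ρ l *ᵥ x := fun l => by fun_prop
  have hcd : ∀ l, ContDiff ℝ 1 fun x : ι → ℝ => φ (ρ l *ᵥ x) := fun l =>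
    hφ.comp (LinearMap.toContinuousLinearMap (ρ l).mulVecLin).contDiff
  have hdc : ∀ {u : (ι → ℝ) → ℝ}, ContDiff ℝ 1 u → ∀ j, Continuous fun x =>
      fderiv ℝ u x (Pi.single j 1) := fun hu j =>
    (hu.continuous_fderiv (by norm_num)).clm_apply continuous_const
  have hYj : ∀ x ∈ C, ∀ j, ContinuousAt (fun x => Y x j) x := fun x hx j =>
    (continuous_apply j).continuousAt.comp (hYc x hx)
  have hint : ∀ {u : (ι → ℝ) → ℝ}, ContDiff ℝ 1 u →
      Integrable fun x => φ x • ∑ j, fderiv ℝ u x (Pi.single j 1) • Y x j := by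
    intro u hu
    refine (continuous_smul_of_tsupport hφ.continuous fun x hx =>
        ?_).integrable_of_hasCompactSupport
      hφc.smul_right
    exact tendsto_finsetSum _ fun j _ =>
      ((hdc hu j).continuousAt.smul (hYj x (hφC hx) j))
  have hzero : ∀ x, x ∉ tsupport φ → fderiv ℝ φ x = 0 := fun x hx =>
    image_eq_zero_of_notMem_tsupport fun h => hx (tsupport_fderiv_subset ℝ h)
  have hint2 : ∀ l, Integrable fun x =>
      φ (ρ l *ᵥ x) • ∑ j, fderiv ℝ φ x (Pi.single j 1) • Y x j := by
    intro l
    have h1 : (fun x => φ (ρ l *ᵥ x) • ∑ j, fderiv ℝ φ x (Pi.single j 1) • Y x j) =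
        fun x => ∑ j, fderiv ℝ φ x (Pi.single j 1) • (φ (ρ l *ᵥ x) • Y x j) := by
      funext x
      rw [Finset.smul_sum]
      exact Finset.sum_congr rfl fun j _ => smul_comm _ _ _
    rw [h1]
    refine integrable_finsetSum _ fun j _ => ?_
    refine (continuous_smul_of_tsupport (hdc hφ j) fun x hx => ?_).integrable_of_hasCompactSupport
        (HasCompactSupport.smul_right (hφc.fderiv_apply ℝ _))
    exact (hφ.continuous.comp (hmc l)).continuousAt.smul
      (hYj x (hφC (tsupport_fderiv_apply_subset ℝ _ hx)) j)
  calc ∫ x, ∑ j, fderiv ℝ φ x (Pi.single j 1) • Y x j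
      = ∫ x, ∑ l ∈ F, φ (ρ l *ᵥ x) • ∑ j, fderiv ℝ φ x (Pi.single j 1) • Y x j := by
        refine integral_congr_ae (Filter.Eventually.of_forall fun x => ?_)
        dsimp only
        by_cases hx : x ∈ tsupport φ
        · rw [← Finset.sum_smul, hsum' x hx, one_smul]
        · simp [hzero x hx]
    _ = ∑ l ∈ F, ∫ x, φ (ρ l *ᵥ x) • ∑ j, fderiv ℝ φ x (Pi.single j 1) • Y x j :=
        integral_finsetSum _ fun l _ => hint2 l
    _ = ∑ l ∈ F, ∫ x, φ x • ∑ j, fderiv ℝ (fun y => φ (ρ l⁻¹ *ᵥ y)) x (Pi.single j 1) • Y x j := by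
        refine Finset.sum_congr rfl fun l _ => ?_
        have hd := det_map_ne_zero ρ l⁻¹
        have h1 := integral_comp_mulVec (g := fun x => φ (ρ l *ᵥ x) •
          ∑ j, fderiv ℝ φ x (Pi.single j 1) • Y x j) hd
        have hd' : |(ρ l⁻¹).det| ≠ 0 := abs_ne_zero.2 hd
        have h2 : (|(ρ l⁻¹).det| : ℝ) • ∫ x, (fun x => φ (ρ l *ᵥ x) •
            ∑ j, fderiv ℝ φ x (Pi.single j 1) • Y x j) (ρ l⁻¹ *ᵥ x) =
            ∫ x, φ (ρ l *ᵥ x) • ∑ j, fderiv ℝ φ x (Pi.single j 1) • Y x j := by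
          rw [h1, smul_smul, mul_inv_cancel₀ hd', one_smul]
        rw [← h2, ← integral_smul]
        refine integral_congr_ae (Filter.Eventually.of_forall fun y => ?_)
        dsimp only
        rw [mulVec_inv_mulVec]
        by_cases hy : y ∈ tsupport φ
        · rw [sum_fderiv_comp_mulVec_smul _ (hφ.differentiable (by norm_num) _), smul_comm,
            Finset.smul_sum]
          congr 1
          refine Finset.sum_congr rfl fun j _ => ?_
          rw [← hY l⁻¹ y (hφC hy) j, smul_comm]
        · simp [image_eq_zero_of_notMem_tsupport hy]
    _ = ∫ x, ∑ l ∈ F, φ x • ∑ j, fderiv ℝ (fun y => φ (ρ l⁻¹ *ᵥ y)) x (Pi.single j 1) • Y x j :=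
        (integral_finsetSum _ fun l _ => hint (hcd l⁻¹)).symm
    _ = ∫ x : ι → ℝ, (0 : ℂ) := by
        refine integral_congr_ae (Filter.Eventually.of_forall fun y => ?_)
        dsimp only
        by_cases hy : φ y = 0
        · simp [hy]
        · have hev : (fun z => ∑ l ∈ F, φ (ρ l⁻¹ *ᵥ z)) =ᶠ[𝓝 y] fun _ => 1 := by
            filter_upwards [(isOpen_ne_fun hφ.continuous continuous_const).mem_nhds hy] with z hz
            exact hsum2 z (hsupp z hz)
          have hder : ∑ l ∈ F, fderiv ℝ (fun z => φ (ρ l⁻¹ *ᵥ z)) y = 0 := by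
            rw [← fderiv_fun_sum fun l _ => (hcd l⁻¹).differentiable (by norm_num) y,
              hev.fderiv_eq]
            simp
          rw [← Finset.smul_sum, Finset.sum_comm]
          have h3 : ∀ j, ∑ l ∈ F, fderiv ℝ (fun z => φ (ρ l⁻¹ *ᵥ z)) y (Pi.single j 1) • Y y j
              = 0 := by
            intro j
            rw [← Finset.sum_smul, ← _root_.sum_apply, hder]
            simp
          rw [Finset.sum_congr rfl fun j _ => h3 j]
          simp
    _ = 0 := by simp

end Unfolding

section Equivariance

open MeasureTheory Topology

variable {ι : Type*} [Fintype ι] [DecidableEq ι]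

lemma cramer_mulVec_of_mul_eq {R : Type*} [CommRing R] [IsDomain R] {A N N' : Matrix ι ι R}
    (hA : A.det ≠ 0) (h : N' * A = A * N) (v : ι → R) :
    N'.cramer (A *ᵥ v) = A *ᵥ N.cramer v := by
  have h1 : A.adjugate * N'.adjugate = N.adjugate * A.adjugate := by
    rw [← adjugate_mul_distrib, ← adjugate_mul_distrib, h]
  have h2 : A.det • (N'.adjugate * A) = A.det • (A * N.adjugate) := by
    calc A.det • (N'.adjugate * A) = A * (A.adjugate * N'.adjugate) * A := by
          rw [← Matrix.mul_assoc, mul_adjugate, smul_mul_assoc, smul_mul_assoc, Matrix.one_mul]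
      _ = A.det • (A * N.adjugate) := by
          rw [h1, Matrix.mul_assoc, Matrix.mul_assoc, adjugate_mul, mul_smul_comm, mul_smul_comm,
            Matrix.mul_one]
  have h3 : N'.adjugate * A = A * N.adjugate := smul_right_injective _ hA h2
  rw [cramer_eq_adjugate_mulVec, cramer_eq_adjugate_mulVec, mulVec_mulVec, mulVec_mulVec, h3]

variable {f : ℝ × (ι → ℝ) → ι → ℂ} {w : ℝ × (ι → ℝ) → ℂ} {C : Set (ι → ℝ)}

/-- The complexification of a real matrix. -/
def complexify (A : Matrix ι ι ℝ) : Matrix ι ι ℂ := A.map (algebraMap ℝ ℂ)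

omit [Fintype ι] [DecidableEq ι] in
lemma complexify_apply (A : Matrix ι ι ℝ) (i j : ι) : complexify A i j = (A i j : ℂ) := rfl

lemma det_complexify (A : Matrix ι ι ℝ) : (complexify A).det = (A.det : ℂ) :=
  (RingHom.map_det (algebraMap ℝ ℂ) A).symm

/-- Multiplication by a complex matrix as a continuous real-linear map. -/
def mulVecCLM (A : Matrix ι ι ℂ) : (ι → ℂ) →L[ℝ] ι → ℂ :=
  LinearMap.toContinuousLinearMap (A.mulVecLin.restrictScalars ℝ)

omit [DecidableEq ι] in
lemma fderiv_equivariant (hC : IsOpen C) (A : Matrix ι ι ℝ)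
    (hf : ∀ z : ℝ × (ι → ℝ), z.2 ∈ C → DifferentiableAt ℝ f z)
    (hCA : ∀ x ∈ C, A *ᵥ x ∈ C)
    (hfA : ∀ t, ∀ x ∈ C, f (t, A *ᵥ x) = complexify A *ᵥ f (t, x))
    {z : ℝ × (ι → ℝ)} (hz : z.2 ∈ C) (v : ℝ × (ι → ℝ)) :
    fderiv ℝ f (z.1, A *ᵥ z.2) (v.1, A *ᵥ v.2) = complexify A *ᵥ fderiv ℝ f z v := by
  set L : ℝ × (ι → ℝ) →L[ℝ] ℝ × (ι → ℝ) := (ContinuousLinearMap.id ℝ ℝ).prodMap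
    (LinearMap.toContinuousLinearMap A.mulVecLin) with hL
  have h1 : HasFDerivAt (fun y => f (L y)) ((fderiv ℝ f (L z)).comp L) z :=
    HasFDerivAt.comp z (hf (L z) (hCA _ hz)).hasFDerivAt L.hasFDerivAt
  have h2 : HasFDerivAt (fun y => mulVecCLM (complexify A) (f y))
      ((mulVecCLM (complexify A)).comp (fderiv ℝ f z)) z :=
    (mulVecCLM (complexify A)).hasFDerivAt.comp z (hf z hz).hasFDerivAt
  have hev : (fun y => f (L y)) =ᶠ[𝓝 z] fun y => mulVecCLM (complexify A) (f y) := by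
    filter_upwards [(hC.preimage continuous_snd).mem_nhds hz] with y hy
    exact hfA y.1 y.2 hy
  have h3 := h1.unique (h2.congr_of_eventuallyEq hev)
  exact DFunLike.congr_fun h3 v

lemma transgression_equivariant (hC : IsOpen C) (A : Matrix ι ι ℝ) (hA : A.det ≠ 0)
    (hf : ∀ z : ℝ × (ι → ℝ), z.2 ∈ C → DifferentiableAt ℝ f z)
    (hCA : ∀ x ∈ C, A *ᵥ x ∈ C)
    (hfA : ∀ t, ∀ x ∈ C, f (t, A *ᵥ x) = complexify A *ᵥ f (t, x))
    (hwA : ∀ t, ∀ x ∈ C, |A.det| • w (t, A *ᵥ x) = w (t, x))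
    (t : ℝ) {x : ι → ℝ} (hx : x ∈ C) (j : ι) :
    |A.det| • transgression f w j (t, A *ᵥ x) =
      ∑ k, (A j k : ℂ) * transgression f w k (t, x) := by
  set M : ι → ι → ℂ := fun i => fderiv ℝ f (t, x) (0, Pi.single i 1) with hM
  set M' : ι → ι → ℂ := fun i => fderiv ℝ f (t, A *ᵥ x) (0, Pi.single i 1) with hM'
  have hder := fun v => fderiv_equivariant hC A hf hCA hfA (z := (t, x)) hx v
  have hτ : fderiv ℝ f (t, A *ᵥ x) (1, 0) = complexify A *ᵥ fderiv ℝ f (t, x) (1, 0) := by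
    simpa using hder (1, 0)
  have hrows : (Matrix.of M')ᵀ * complexify A = complexify A * (Matrix.of M)ᵀ := by
    ext k i
    have h1 := congrFun (hder (0, Pi.single i 1)) k
    have h2 : ((0 : ℝ), A *ᵥ Pi.single i 1) =
        ∑ l, A l i • ((0 : ℝ), (Pi.single l 1 : ι → ℝ)) := by
      have h3 : A *ᵥ Pi.single i 1 = ∑ k, A k i • (Pi.single k 1 : ι → ℝ) := by
        rw [Matrix.mulVec_single_one]
        exact pi_eq_sum_univ' _
      rw [h3]
      ext1
      · simp [Prod.fst_sum]
      · simp [Prod.snd_sum]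
    simp only [h2, map_sum, map_smul] at h1
    rw [Matrix.mul_apply, Matrix.mul_apply]
    refine Eq.trans ?_ (h1.trans ?_)
    · simp only [Finset.sum_apply, Pi.smul_apply, Complex.real_smul]
      refine Finset.sum_congr rfl fun l _ => ?_
      simp [hM', complexify_apply, mul_comm]
    · rfl
  have hcr := cramer_mulVec_of_mul_eq (by rwa [det_complexify, Complex.ofReal_ne_zero]) hrows
    (fderiv ℝ f (t, x) (1, 0))
  rw [← hτ] at hcr
  have h := congrFun hcr j
  rw [Matrix.cramer_transpose_apply] at h
  have hwx := hwA t x hx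
  have key : transgression f w j (t, A *ᵥ x) = w (t, A *ᵥ x) *
      ∑ k, (A j k : ℂ) * rowDet ι (Function.update M k (fderiv ℝ f (t, x) (1, 0))) := by
    refine congrArg (w (t, A *ᵥ x) * ·) (Eq.trans h ?_)
    simp only [Matrix.mulVec, dotProduct, Matrix.cramer_transpose_apply]
    rfl
  rw [key, ← smul_mul_assoc, hwx, Finset.mul_sum]
  refine Finset.sum_congr rfl fun k _ => ?_
  simp only [transgression]
  ring

end Equivariance

section LogLift

open MeasureTheory Topology

variable {E : Type*} [NormedAddCommGroup E] [NormedSpace ℝ E]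

/-- A continuous logarithm of a smooth function is smooth. -/
lemma contDiffAt_of_exp {n : WithTop ℕ∞} {l g : E → ℂ} {z : E} (hl : ContinuousAt l z)
    (hg : ContDiffAt ℝ n g z) (h : ∀ᶠ y in 𝓝 z, Complex.exp (l y) = g y) :
    ContDiffAt ℝ n l z := by
  have hgz : g z = Complex.exp (l z) := h.self_of_nhds.symm
  have h1 : ContDiffAt ℝ n (fun y => l z + Complex.log (g y / g z)) z := by
    refine contDiffAt_const.add ?_
    have h2 : ContDiffAt ℝ n Complex.log (g z / g z) := by
      refine (Complex.contDiffAt_log ?_).restrict_scalars ℝ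
      rw [div_self (by rw [hgz]; exact Complex.exp_ne_zero _)]
      exact Complex.one_mem_slitPlane
    exact h2.comp z (hg.div_const _)
  refine h1.congr_of_eventuallyEq ?_
  have h3 : ∀ᶠ y in 𝓝 z, ‖l y - l z‖ < Real.pi := by
    have : ContinuousAt (fun y => ‖l y - l z‖) z := (hl.sub continuousAt_const).norm
    exact this.eventually_lt continuousAt_const (by simpa using Real.pi_pos)
  filter_upwards [h, h3] with y hy hy3
  have h4 : |(l y - l z).im| < Real.pi := (Complex.abs_im_le_norm _).trans_lt hy3
  rw [abs_lt] at h4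
  rw [← hy, hgz, ← Complex.exp_sub, Complex.log_exp h4.1 h4.2.le]
  ring

/-- The continuous logarithm along the first variable, normalized to vanish at time `0`. -/
def logLift (g : ℝ × E → ℂ) (z : ℝ × E) : ℂ :=
  ∫ τ in (0 : ℝ)..z.1, deriv (fun s => g (s, z.2)) τ / g (τ, z.2)

omit [NormedAddCommGroup E] [NormedSpace ℝ E] in
lemma logLift_zero (g : ℝ × E → ℂ) (x : E) : logLift g (0, x) = 0 := by simp [logLift]

omit [NormedAddCommGroup E] [NormedSpace ℝ E] in
lemma logLift_congr {g : ℝ × E → ℂ} {x y : E} (h : ∀ t, g (t, x) = g (t, y)) (t : ℝ) :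
    logLift g (t, x) = logLift g (t, y) := by
  simp [logLift, h]

variable {g : ℝ × E → ℂ} {C : Set E}

lemma hasDerivAt_slice {z : ℝ × E} (h : DifferentiableAt ℝ g z) :
    HasDerivAt (fun s => g (s, z.2)) (fderiv ℝ g z (1, 0)) z.1 := by
  have h1 : HasDerivAt (fun s : ℝ => (s, z.2)) ((1 : ℝ), (0 : E)) z.1 :=
    (hasDerivAt_id z.1).prodMk (hasDerivAt_const z.1 z.2)
  exact h.hasFDerivAt.comp_hasDerivAt z.1 h1

lemma exp_logLift (hg : ∀ z : ℝ × E, z.2 ∈ C → ContDiffAt ℝ 1 g z)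
    (hg0 : ∀ z : ℝ × E, z.2 ∈ C → g z ≠ 0) (hg1 : ∀ x ∈ C, g (0, x) = 1)
    {z : ℝ × E} (hz : z.2 ∈ C) : Complex.exp (logLift g z) = g z := by
  obtain ⟨t, x⟩ := z
  have hd : ∀ s, HasDerivAt (fun s => g (s, x)) (fderiv ℝ g (s, x) (1, 0)) s := fun s =>
    hasDerivAt_slice (z := (s, x)) ((hg (s, x) hz).differentiableAt (by norm_num))
  have hcont : Continuous fun s : ℝ => deriv (fun s => g (s, x)) s / g (s, x) := by
    rw [continuous_iff_continuousAt]
    intro s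
    have h1 : (deriv fun s => g (s, x)) = fun s => fderiv ℝ g (s, x) (1, 0) :=
      funext fun s => (hd s).deriv
    rw [h1]
    have h2 : ContinuousAt (fun s : ℝ => fderiv ℝ g (s, x) (1, 0)) s := by
      have := ((hg (s, x) hz).fderiv_right (m := 0) (by norm_num)).continuousAt
      have h3 : ContinuousAt (fun s : ℝ => fderiv ℝ g (s, x)) s :=
        ContinuousAt.comp (f := fun s : ℝ => (s, x)) this (by fun_prop)
      exact h3.clm_apply continuousAt_const
    exact h2.div (hd s).continuousAt (hg0 (s, x) hz)
  have hl : ∀ s, HasDerivAt (fun s => logLift g (s, x))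
      (deriv (fun s => g (s, x)) s / g (s, x)) s := fun s =>
    intervalIntegral.integral_hasDerivAt_right (hcont.intervalIntegrable _ _)
      (hcont.stronglyMeasurableAtFilter _ _) hcont.continuousAt
  have hq : ∀ s, HasDerivAt (fun s => Complex.exp (- logLift g (s, x)) * g (s, x)) 0 s := by
    intro s
    have h1 := (hl s).neg.cexp.mul (hd s)
    refine h1.congr_deriv ?_
    rw [(hd s).deriv]
    have := hg0 (s, x) hz
    field_simp
    ring_nf
  have hconst := is_const_of_deriv_eq_zero (fun s => (hq s).differentiableAt)
    (fun s => (hq s).deriv) t 0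
  simp only [logLift_zero, neg_zero, Complex.exp_zero, one_mul, hg1 x hz] at hconst
  rw [Complex.exp_neg, inv_mul_eq_one₀ (Complex.exp_ne_zero _)] at hconst
  exact hconst

lemma continuousAt_logLift (hC : IsOpen C) (hg : ∀ z : ℝ × E, z.2 ∈ C → ContDiffAt ℝ 1 g z)
    (hg0 : ∀ z : ℝ × E, z.2 ∈ C → g z ≠ 0) {z : ℝ × E} (hz : z.2 ∈ C) :
    ContinuousAt (logLift g) z := by
  have hd : ∀ z : ℝ × E, z.2 ∈ C → deriv (fun s => g (s, z.2)) z.1 = fderiv ℝ g z (1, 0) :=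
    fun z hz => (hasDerivAt_slice ((hg z hz).differentiableAt (by norm_num))).deriv
  have hc : Continuous (Function.uncurry fun (x : C) (s : ℝ) =>
      deriv (fun s => g (s, (x : E))) s / g (s, x)) := by
    rw [continuous_iff_continuousAt]
    rintro ⟨x, s⟩
    have h1 : (Function.uncurry fun (x : C) (s : ℝ) =>
        deriv (fun s => g (s, (x : E))) s / g (s, x)) =
        fun p : C × ℝ => fderiv ℝ g (p.2, (p.1 : E)) (1, 0) / g (p.2, p.1) := by
      funext p
      simp only [Function.uncurry]
      rw [← hd (p.2, (p.1 : E)) p.1.2]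
    rw [h1]
    have hi : ContinuousAt (fun p : C × ℝ => (p.2, (p.1 : E))) (x, s) := by fun_prop
    have h2 := ((hg (s, x) x.2).fderiv_right (m := 0) (by norm_num)).continuousAt
    have h3 : ContinuousAt (fun p : C × ℝ => fderiv ℝ g (p.2, (p.1 : E))) (x, s) :=
      ContinuousAt.comp (f := fun p : C × ℝ => (p.2, (p.1 : E))) h2 hi
    have h4 : ContinuousAt (fun p : C × ℝ => g (p.2, (p.1 : E))) (x, s) :=
      ContinuousAt.comp (f := fun p : C × ℝ => (p.2, (p.1 : E))) (hg (s, x) x.2).continuousAt hi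
    exact (h3.clm_apply continuousAt_const).div h4 (hg0 (s, x) x.2)
  have h5 := intervalIntegral.continuous_parametric_primitive_of_continuous (μ := volume)
    (a₀ := 0) hc
  have h6 : ContinuousOn (logLift g) (Prod.snd ⁻¹' C) := by
    rw [continuousOn_iff_continuous_domRestrict]
    exact h5.comp (f := fun p : (Prod.snd ⁻¹' C : Set (ℝ × E)) =>
      ((⟨p.1.2, p.2⟩ : C), p.1.1)) (by fun_prop)
  exact h6.continuousAt ((hC.preimage continuous_snd).mem_nhds hz)

lemma contDiffAt_logLift (hC : IsOpen C) (hg : ∀ z : ℝ × E, z.2 ∈ C → ContDiffAt ℝ 1 g z)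
    (hg0 : ∀ z : ℝ × E, z.2 ∈ C → g z ≠ 0) (hg1 : ∀ x ∈ C, g (0, x) = 1)
    {z : ℝ × E} (hz : z.2 ∈ C) : ContDiffAt ℝ 1 (logLift g) z := by
  refine contDiffAt_of_exp (continuousAt_logLift hC hg hg0 hz) (hg z hz) ?_
  filter_upwards [(hC.preimage continuous_snd).mem_nhds hz] with y hy
  exact exp_logLift hg hg0 hg1 hy

lemma fderiv_logLift (hC : IsOpen C) (hg : ∀ z : ℝ × E, z.2 ∈ C → ContDiffAt ℝ 1 g z)
    (hg0 : ∀ z : ℝ × E, z.2 ∈ C → g z ≠ 0) (hg1 : ∀ x ∈ C, g (0, x) = 1)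
    {z : ℝ × E} (hz : z.2 ∈ C) (v : ℝ × E) :
    g z * fderiv ℝ (logLift g) z v = fderiv ℝ g z v := by
  have h1 := ((contDiffAt_logLift hC hg hg0 hg1 hz).differentiableAt (by norm_num)).hasFDerivAt.cexp
  have h2 : (fun y => Complex.exp (logLift g y)) =ᶠ[𝓝 z] g := by
    filter_upwards [(hC.preimage continuous_snd).mem_nhds hz] with y hy
    exact exp_logLift hg hg0 hg1 hy
  have h3 := h1.congr_of_eventuallyEq h2.symm
  rw [h3.fderiv, exp_logLift hg hg0 hg1 hz]
  simp

end LogLift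

section Averaging

open MeasureTheory Topology

variable {ι : Type*} [Fintype ι]

lemma exists_smooth_cutoff {K U : Set (ι → ℝ)} (hK : IsCompact K) (hU : IsOpen U) (hKU : K ⊆ U) :
    ∃ u : (ι → ℝ) → ℝ, ContDiff ℝ 2 u ∧ HasCompactSupport u ∧ tsupport u ⊆ U ∧
      (∀ x, 0 ≤ u x) ∧ ∀ x ∈ K, ∀ᶠ y in 𝓝 x, u y = 1 := by
  obtain ⟨L, hL, hKL, hLU⟩ := exists_compact_between hK hU hKU
  obtain ⟨f, hf1, hf0, hf⟩ := exists_contMDiffMap_one_nhds_of_subset_interior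
    (modelWithCornersSelf ℝ (ι → ℝ)) (n := 2) hK.isClosed hKL
  have hts : tsupport f ⊆ L := closure_minimal
    (fun x hx => by_contra fun h => hx (hf0 x h)) hL.isClosed
  refine ⟨f, f.contMDiff.contDiff, hL.of_isClosed_subset (isClosed_tsupport _) hts,
    hts.trans hLU, fun x => (hf x).1, fun x hx => ?_⟩
  exact (eventually_nhdsSet_iff_forall.1 hf1) x hx

variable [DecidableEq ι] {Λ : Type*} [Group Λ] {ρ : Λ →* Matrix ι ι ℝ} {U : Set (ι → ℝ)}

/-- The linear action given by `ρ` preserves the open set `U` and is properly discontinuous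
on it. -/
structure ProperOn (ρ : Λ →* Matrix ι ι ℝ) (U : Set (ι → ℝ)) : Prop where
  isOpen : IsOpen U
  mulVec_mem : ∀ l, ∀ x ∈ U, ρ l *ᵥ x ∈ U
  finite : ∀ K ⊆ U, IsCompact K → {l | ∃ x ∈ K, ρ l *ᵥ x ∈ K}.Finite

lemma ProperOn.eventually_notMem (h : ProperOn ρ U) {K : Set (ι → ℝ)} (hK : IsCompact K)
    (hKU : K ⊆ U) {x : ι → ℝ} (hx : x ∈ U) :
    ∃ F : Finset Λ, ∀ᶠ y in 𝓝 x, ∀ l, ρ l *ᵥ y ∈ K → l ∈ F := by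
  obtain ⟨N, hN, hNU, hNc⟩ := local_compact_nhds (h.isOpen.mem_nhds hx)
  have hfin := h.finite (K ∪ N) (Set.union_subset hKU hNU) (hK.union hNc)
  refine ⟨hfin.toFinset, ?_⟩
  filter_upwards [hN] with y hy l hl
  rw [Set.Finite.mem_toFinset]
  exact ⟨y, Or.inr hy, Or.inl hl⟩

variable {V : Type*} [NormedAddCommGroup V] [NormedSpace ℝ V]

/-- The weighted sum of `c` over the group, with weights the values of `u` along the orbit. -/
def orbitSum (ρ : Λ →* Matrix ι ι ℝ) (u : (ι → ℝ) → ℝ) (c : Λ → V) (x : ι → ℝ) : V :=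
  ∑ᶠ l, u (ρ l *ᵥ x) • c l

variable {u : (ι → ℝ) → ℝ} {c : Λ → V}

lemma ProperOn.orbitSum_eventually (h : ProperOn ρ U) (hu : HasCompactSupport u)
    (huU : tsupport u ⊆ U) (c : Λ → V) {x : ι → ℝ} (hx : x ∈ U) :
    ∃ F : Finset Λ, ∀ᶠ y in 𝓝 x, (∀ l, u (ρ l *ᵥ y) ≠ 0 → l ∈ F) ∧
      orbitSum ρ u c y = ∑ l ∈ F, u (ρ l *ᵥ y) • c l := by
  obtain ⟨F, hF⟩ := h.eventually_notMem hu huU hx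
  refine ⟨F, hF.mono fun y hy => ⟨fun l hl => hy l (subset_tsupport u hl), ?_⟩⟩
  refine finsum_eq_sum_of_support_subset _ fun l hl => hy l (subset_tsupport u ?_)
  intro h0
  exact hl (by simp [h0])

lemma ProperOn.contDiffAt_orbitSum (h : ProperOn ρ U) (hu2 : ContDiff ℝ 2 u)
    (hu : HasCompactSupport u) (huU : tsupport u ⊆ U) (c : Λ → V) {x : ι → ℝ} (hx : x ∈ U) :
    ContDiffAt ℝ 2 (orbitSum ρ u c) x := by
  obtain ⟨F, hF⟩ := h.orbitSum_eventually hu huU c hx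
  have h1 : ContDiff ℝ 2 fun y => ∑ l ∈ F, u (ρ l *ᵥ y) • c l :=
    ContDiff.sum fun l _ => (hu2.comp
      (LinearMap.toContinuousLinearMap (ρ l).mulVecLin).contDiff).smul contDiff_const
  exact h1.contDiffAt.congr_of_eventuallyEq (hF.mono fun y hy => hy.2)

lemma orbitSum_mulVec (m : Λ) (x : ι → ℝ) :
    orbitSum ρ u c (ρ m *ᵥ x) = orbitSum ρ u (fun l => c (l * m⁻¹)) x := by
  unfold orbitSum
  rw [← finsum_comp_equiv (Equiv.mulRight m⁻¹)]
  refine finsum_congr fun l => ?_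
  simp [mulVec_mulVec, ← map_mul]

variable {C Ω D : Set (ι → ℝ)}

/-- An equivariant smooth map from a cocompact domain to an invariant convex cone. -/
lemma exists_equivariant_map (hC : ProperOn ρ C) (hΩ : ∀ l, ∀ x ∈ Ω, ρ l *ᵥ x ∈ Ω)
    (hadd : ∀ x ∈ Ω, ∀ y ∈ Ω, x + y ∈ Ω) (hsmul : ∀ r : ℝ, 0 < r → ∀ x ∈ Ω, r • x ∈ Ω)
    (hD : IsCompact D) (hDC : D ⊆ C) (hcov : ∀ x ∈ C, ∃ l, ρ l *ᵥ x ∈ D) (hne : Ω.Nonempty) :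
    ∃ P : (ι → ℝ) → ι → ℝ, (∀ x ∈ C, ContDiffAt ℝ 2 P x) ∧ (∀ x ∈ C, P x ∈ Ω) ∧
      ∀ l, ∀ x ∈ C, P (ρ l *ᵥ x) = ρ l *ᵥ P x := by
  obtain ⟨e, he⟩ := hne
  obtain ⟨u, hu2, huc, huC, hu0, hu1⟩ := exists_smooth_cutoff hD hC.isOpen hDC
  refine ⟨orbitSum ρ u fun l => ρ l⁻¹ *ᵥ e, fun x hx => hC.contDiffAt_orbitSum hu2 huc huC _ hx,
    fun x hx => ?_, fun l x hx => ?_⟩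
  · obtain ⟨F, hF⟩ := hC.orbitSum_eventually huc huC (fun l => ρ l⁻¹ *ᵥ e) hx
    obtain ⟨h1, h2⟩ := hF.self_of_nhds
    rw [h2, ← Finset.sum_filter_of_ne (p := fun l => u (ρ l *ᵥ x) ≠ 0)
      (fun l _ hl h0 => hl (by simp [h0]))]
    refine Finset.sum_induction_nonempty _ (· ∈ Ω) (fun a b ha hb => hadd a ha b hb) ?_ ?_
    · obtain ⟨l, hl⟩ := hcov x hx
      have h3 : u (ρ l *ᵥ x) ≠ 0 := by rw [(hu1 _ hl).self_of_nhds]; exact one_ne_zero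
      exact ⟨l, Finset.mem_filter.2 ⟨h1 l h3, h3⟩⟩
    · intro l hl
      exact hsmul _ (lt_of_le_of_ne (hu0 _) (Ne.symm (Finset.mem_filter.1 hl).2)) _
        (hΩ _ _ he)
  · rw [orbitSum_mulVec]
    obtain ⟨F, hF⟩ := hC.orbitSum_eventually huc huC (fun l => ρ l⁻¹ *ᵥ e) hx
    obtain ⟨h1, h2⟩ := hF.self_of_nhds
    rw [h2, Matrix.mulVec_sum, orbitSum, finsum_eq_sum_of_support_subset (s := F)]
    · refine Finset.sum_congr rfl fun m _ => ?_
      rw [mulVec_smul, mulVec_mulVec, ← map_mul, _root_.mul_inv_rev, inv_inv]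
    · intro m hm
      refine h1 m fun h0 => hm ?_
      simp [h0]

variable {P : (ι → ℝ) → ι → ℝ}

lemma isCompact_inter_preimage (hC : ProperOn ρ C) (hΩ : ProperOn ρ Ω)
    (hD : IsCompact D) (hDC : D ⊆ C) (hcov : ∀ x ∈ C, ∃ l, ρ l *ᵥ x ∈ D)
    (hP : ContinuousOn P C) (hPΩ : ∀ x ∈ C, P x ∈ Ω)
    (hPρ : ∀ l, ∀ x ∈ C, P (ρ l *ᵥ x) = ρ l *ᵥ P x) {K : Set (ι → ℝ)} (hK : IsCompact K)
    (hKΩ : K ⊆ Ω) : IsCompact (C ∩ P ⁻¹' K) := by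
  have hPD : IsCompact (P '' D) := hD.image_of_continuousOn (hP.mono hDC)
  have hfin := hΩ.finite (K ∪ P '' D) (Set.union_subset hKΩ (by
    rintro _ ⟨x, hx, rfl⟩; exact hPΩ x (hDC hx))) (hK.union hPD)
  have hc : ∀ l, IsCompact ((fun x => ρ l *ᵥ x) '' D) := fun l => hD.image (by fun_prop)
  have hsub : ∀ l, (fun x => ρ l *ᵥ x) '' D ⊆ C := by
    rintro l _ ⟨x, hx, rfl⟩
    exact hC.mulVec_mem l x (hDC hx)
  have hc2 : ∀ l, IsCompact ((fun x => ρ l *ᵥ x) '' D ∩ P ⁻¹' K) := fun l =>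
    (hc l).of_isClosed_subset
      ((hP.mono (hsub l)).preimage_isClosed_of_isClosed (hc l).isClosed hK.isClosed)
      Set.inter_subset_left
  have heq : C ∩ P ⁻¹' K = ⋃ l ∈ hfin.toFinset, ((fun x => ρ l *ᵥ x) '' D ∩ P ⁻¹' K) := by
    ext x
    simp only [Set.mem_inter_iff, Set.mem_preimage, Set.mem_iUnion, exists_prop]
    constructor
    · rintro ⟨hx, hxK⟩
      obtain ⟨l, hl⟩ := hcov x hx
      refine ⟨l⁻¹, ?_, ⟨_, hl, inv_mulVec_mulVec ρ l x⟩, hxK⟩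
      rw [Set.Finite.mem_toFinset]
      refine ⟨P (ρ l *ᵥ x), Or.inr ⟨_, hl, rfl⟩, Or.inl ?_⟩
      rwa [hPρ l x hx, inv_mulVec_mulVec]
    · rintro ⟨l, -, hx, hxK⟩
      exact ⟨hsub l hx, hxK⟩
  rw [heq]
  exact hfin.toFinset.isCompact_biUnion fun l _ => hc2 l

omit [DecidableEq ι] in
lemma eventually_notMem_image
    (hproper : ∀ K ⊆ Ω, IsCompact K → IsCompact (C ∩ P ⁻¹' K)) (hΩo : IsOpen Ω)
    (hP : ContinuousOn P C) {y : ι → ℝ} (hy : y ∈ Ω) (hyP : y ∉ P '' C) :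
    ∀ᶠ z in 𝓝 y, z ∉ P '' C := by
  obtain ⟨N, hN, hNΩ, hNc⟩ := local_compact_nhds (hΩo.mem_nhds hy)
  have h1 : IsCompact (P '' (C ∩ P ⁻¹' N)) :=
    (hproper N hNΩ hNc).image_of_continuousOn (hP.mono Set.inter_subset_left)
  have h2 : y ∉ P '' (C ∩ P ⁻¹' N) := fun h => hyP (Set.image_mono Set.inter_subset_left h)
  filter_upwards [hN, h1.isClosed.isOpen_compl.mem_nhds h2] with z hz hz2
  rintro ⟨x, hx, rfl⟩
  exact hz2 ⟨x, ⟨hx, hz⟩, rfl⟩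

lemma contDiff_of_tsupport_contDiffAt {E F : Type*} [NormedAddCommGroup E] [NormedSpace ℝ E]
    [NormedAddCommGroup F] [NormedSpace ℝ F] {n : WithTop ℕ∞} {f : E → F}
    (h : ∀ x ∈ tsupport f, ContDiffAt ℝ n f x) : ContDiff ℝ n f := by
  rw [contDiff_iff_contDiffAt]
  intro x
  by_cases hx : x ∈ tsupport f
  · exact h x hx
  · exact contDiffAt_const.congr_of_eventuallyEq (notMem_tsupport_iff_eventuallyEq.1 hx)

lemma exists_normalized_cutoff (hΩ : ProperOn ρ Ω) {K : Set (ι → ℝ)} (hK : IsCompact K)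
    (hKΩ : K ⊆ Ω) : ∃ b : (ι → ℝ) → ℝ, ContDiff ℝ 2 b ∧ HasCompactSupport b ∧ tsupport b ⊆ Ω ∧
      (∀ x, 0 ≤ b x) ∧ ∀ l, ∀ x ∈ K, orbitSum ρ b (fun _ => (1 : ℝ)) (ρ l *ᵥ x) = 1 := by
  obtain ⟨u, hu2, huc, huΩ, hu0, hu1⟩ := exists_smooth_cutoff hK hΩ.isOpen hKΩ
  set H := orbitSum ρ u fun _ => (1 : ℝ) with hH
  have hH0 : ∀ x, 0 ≤ H x := fun x => finsum_nonneg fun l => by simpa using hu0 _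
  have hHinv : ∀ l x, H (ρ l *ᵥ x) = H x := fun l x => orbitSum_mulVec l x
  have hH1 : ∀ x ∈ K, 1 ≤ H x := by
    intro x hx
    obtain ⟨F, hF⟩ := hΩ.orbitSum_eventually huc huΩ (fun _ => (1 : ℝ)) (hKΩ hx)
    obtain ⟨h1, h2⟩ := hF.self_of_nhds
    have h3 : u (ρ 1 *ᵥ x) = 1 := by
      rw [map_one, one_mulVec]; exact (hu1 x hx).self_of_nhds
    rw [hH, h2]
    simp only [smul_eq_mul, mul_one]
    rw [← h3]
    exact Finset.single_le_sum (f := fun l => u (ρ l *ᵥ x)) (fun l _ => hu0 _)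
      (h1 1 (by rw [h3]; exact one_ne_zero))
  set q : ℝ → ℝ := fun s => s + 1 - Real.smoothTransition s with hq
  have hq0 : ∀ s, 0 ≤ s → 0 < q s := by
    intro s hs
    rcases hs.eq_or_lt with rfl | hs
    · simp [hq]
    · have := Real.smoothTransition.le_one s
      simp only [hq]; linarith
  have hq1 : ∀ s, 1 ≤ s → q s = s := fun s hs => by
    simp [hq, Real.smoothTransition.one_of_one_le hs]
  have hqs : ContDiff ℝ 2 q := (contDiff_id.add contDiff_const).sub Real.smoothTransition.contDiff
  have hsupp : tsupport (fun x => u x / q (H x)) ⊆ tsupport u := by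
    refine closure_mono fun x hx h0 => hx ?_
    simp [h0]
  refine ⟨fun x => u x / q (H x), ?_, ?_, hsupp.trans huΩ,
    fun x => div_nonneg (hu0 x) (hq0 _ (hH0 x)).le, fun l x hx => ?_⟩
  · refine contDiff_of_tsupport_contDiffAt fun x hx => ?_
    exact hu2.contDiffAt.div (hqs.contDiffAt.comp x
      (hΩ.contDiffAt_orbitSum hu2 huc huΩ _ (huΩ (hsupp hx)))) (hq0 _ (hH0 x)).ne'
  · exact huc.of_isClosed_subset (isClosed_tsupport _) hsupp
  · have h1 : 1 ≤ H (ρ l *ᵥ x) := by rw [hHinv]; exact hH1 x hx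
    have h2 : orbitSum ρ (fun x => u x / q (H x)) (fun _ => (1 : ℝ)) (ρ l *ᵥ x) =
        ∑ᶠ m, u (ρ m *ᵥ (ρ l *ᵥ x)) • (q (H (ρ l *ᵥ x)))⁻¹ := by
      refine finsum_congr fun m => ?_
      simp only [hHinv, smul_eq_mul, mul_one, div_eq_mul_inv]
    rw [h2, ← finsum_smul, hq1 _ h1]
    have h3 : ∑ᶠ m, u (ρ m *ᵥ (ρ l *ᵥ x)) = H (ρ l *ᵥ x) := by simp [hH, orbitSum]
    rw [h3, smul_eq_mul, mul_inv_cancel₀ (by linarith)]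

omit [DecidableEq ι] in
/-- Pulling back compactly supported functions by a proper smooth map defined on an open set. -/
lemma indicator_comp_contDiff {F : Type*} [NormedAddCommGroup F] [NormedSpace ℝ F]
    (hCo : IsOpen C) (hP : ∀ x ∈ C, ContDiffAt ℝ 2 P x)
    (hproper : ∀ K ⊆ Ω, IsCompact K → IsCompact (C ∩ P ⁻¹' K)) {b : (ι → ℝ) → F}
    (hb : ContDiff ℝ 2 b) (hbc : HasCompactSupport b) (hbΩ : tsupport b ⊆ Ω) :
    ContDiff ℝ 2 (C.indicator fun x => b (P x)) ∧
      HasCompactSupport (C.indicator fun x => b (P x)) ∧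
      tsupport (C.indicator fun x => b (P x)) ⊆ C := by
  have hK := hproper _ hbΩ hbc
  have hsub : tsupport (C.indicator fun x => b (P x)) ⊆ C ∩ P ⁻¹' tsupport b := by
    refine closure_minimal (fun x hx => ?_) hK.isClosed
    have hxC : x ∈ C := Set.mem_of_indicator_ne_zero hx
    refine ⟨hxC, subset_tsupport b ?_⟩
    rwa [Function.mem_support, Set.indicator_of_mem hxC] at hx
  have hsub2 := hsub.trans Set.inter_subset_left
  refine ⟨contDiff_of_tsupport_contDiffAt fun x hx => ?_,
    hK.of_isClosed_subset (isClosed_tsupport _) hsub,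
    hsub2⟩
  have hxC := hsub2 hx
  refine (hb.contDiffAt.comp x (hP x hxC)).congr_of_eventuallyEq ?_
  filter_upwards [hCo.mem_nhds hxC] with y hy
  rw [Set.indicator_of_mem hy]
  rfl

end Averaging

section FirstHomotopy

open MeasureTheory Topology

variable {ι : Type*} [Fintype ι] [DecidableEq ι]

/-- The inclusion of real vectors in complex vectors. -/
def cx : (ι → ℝ) →L[ℝ] ι → ℂ :=
  ContinuousLinearMap.pi fun i => Complex.ofRealCLM.comp (ContinuousLinearMap.proj i)

omit [Fintype ι] [DecidableEq ι] in
lemma cx_apply (x : ι → ℝ) (i : ι) : cx x i = (x i : ℂ) := rfl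

omit [DecidableEq ι] in
lemma contDiff_cx {n : WithTop ℕ∞} : ContDiff ℝ n fun x : ι → ℝ => cx x :=
  ContinuousLinearMap.contDiff (cx (ι := ι))

omit [DecidableEq ι] in
lemma cx_mulVec (A : Matrix ι ι ℝ) (x : ι → ℝ) : cx (A *ᵥ x) = complexify A *ᵥ cx x := by
  funext i
  simp [cx_apply, mulVec, dotProduct, complexify_apply]

variable {Λ : Type*} [Group Λ]

/-- `δ` is a holomorphic relative invariant with character `χ`, real on real vectors, whose
suitable power transforms like the inverse of a volume form. -/
structure RelInvariant (ρ : Λ →* Matrix ι ι ℝ) (χ : Λ → ℝ) (κ : ℝ) (δ : (ι → ℂ) → ℂ)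
    (d : (ι → ℝ) → ℝ) : Prop where
  contDiff : ContDiff ℂ 2 δ
  apply_cx : ∀ x, δ (cx x) = d x
  apply_I_smul : ∃ u : ℂ, ∀ z, δ (Complex.I • z) = u * δ z
  apply_mulVec : ∀ l z, δ (complexify (ρ l) *ᵥ z) = χ l * δ z
  pos : ∀ l, 0 < χ l
  abs_det : ∀ l, |(ρ l).det| = Real.exp (κ * Real.log (χ l))

variable {ρ : Λ →* Matrix ι ι ℝ} {χ : Λ → ℝ} {κ : ℝ} {δ : (ι → ℂ) → ℂ} {d : (ι → ℝ) → ℝ}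

lemma RelInvariant.contDiff_real (h : RelInvariant ρ χ κ δ d) : ContDiff ℝ 2 d := by
  have h1 : d = fun x => (δ (cx x)).re := by
    funext x; rw [h.apply_cx, Complex.ofReal_re]
  rw [h1]
  exact Complex.reCLM.contDiff.comp ((h.contDiff.restrict_scalars ℝ).comp contDiff_cx)

lemma RelInvariant.apply_real_mulVec (h : RelInvariant ρ χ κ δ d) (l : Λ) (x : ι → ℝ) :
    d (ρ l *ᵥ x) = χ l * d x := by
  have h1 := h.apply_mulVec l (cx x)
  rw [← cx_mulVec, h.apply_cx, h.apply_cx] at h1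
  exact_mod_cast h1

variable {C Ω : Set (ι → ℝ)} {P : (ι → ℝ) → ι → ℝ}

/-- The straight homotopy from the inclusion to `i P`. -/
def complexHomotopy (P : (ι → ℝ) → ι → ℝ) (z : ℝ × (ι → ℝ)) : ι → ℂ :=
  (1 - z.1) • cx z.2 + z.1 • (Complex.I • cx (P z.2))

/-- The weight `δ ^ (-κ)` along the homotopy, for a continuous choice of the power. -/
def homotopyWeight (κ : ℝ) (δ : (ι → ℂ) → ℂ) (d : (ι → ℝ) → ℝ) (P : (ι → ℝ) → ι → ℝ)
    (z : ℝ × (ι → ℝ)) : ℂ :=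
  Complex.exp (-κ * (Real.log (d z.2) +
    logLift (fun z => δ (complexHomotopy P z) / d z.2) z))

omit [DecidableEq ι] in
lemma contDiffAt_complexHomotopy (hP : ∀ x ∈ C, ContDiffAt ℝ 2 P x) {z : ℝ × (ι → ℝ)}
    (hz : z.2 ∈ C) : ContDiffAt ℝ 2 (complexHomotopy P) z := by
  have h1 : ContDiffAt ℝ 2 (fun z : ℝ × (ι → ℝ) => P z.2) z :=
    (hP _ hz).comp z contDiffAt_snd
  have h2 : ContDiffAt ℝ 2 (fun z : ℝ × (ι → ℝ) => cx (P z.2)) z :=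
    contDiff_cx.contDiffAt.comp z h1
  have h3 : ContDiffAt ℝ 2 (fun z : ℝ × (ι → ℝ) => cx z.2) z :=
    contDiff_cx.contDiffAt.comp z contDiffAt_snd
  exact ((contDiffAt_const.sub contDiffAt_fst).smul h3).add
    (contDiffAt_fst.smul (h2.const_smul Complex.I))

lemma complexHomotopy_equivariant (hPρ : ∀ l, ∀ x ∈ C, P (ρ l *ᵥ x) = ρ l *ᵥ P x) (l : Λ)
    (t : ℝ) {x : ι → ℝ} (hx : x ∈ C) :
    complexHomotopy P (t, ρ l *ᵥ x) = complexify (ρ l) *ᵥ complexHomotopy P (t, x) := by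
  simp only [complexHomotopy, hPρ l x hx, cx_mulVec, mulVec_add, mulVec_smul]

variable (h : RelInvariant ρ χ κ δ d) (hCo : IsOpen C)
  (hP : ∀ x ∈ C, ContDiffAt ℝ 2 P x) (hPρ : ∀ l, ∀ x ∈ C, P (ρ l *ᵥ x) = ρ l *ᵥ P x)
  (hd : ∀ x ∈ C, d x ≠ 0) (hδ : ∀ z : ℝ × (ι → ℝ), z.2 ∈ C → δ (complexHomotopy P z) ≠ 0)

include h hP hd in
lemma contDiffAt_quotient {z : ℝ × (ι → ℝ)} (hz : z.2 ∈ C) :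
    ContDiffAt ℝ 1 (fun z => δ (complexHomotopy P z) / (d z.2 : ℂ)) z := by
  have h1 : ContDiffAt ℝ 2 (fun z => δ (complexHomotopy P z)) z :=
    (h.contDiff.restrict_scalars ℝ).contDiffAt.comp z (contDiffAt_complexHomotopy hP hz)
  have h2 : ContDiffAt ℝ 2 (fun z : ℝ × (ι → ℝ) => (d z.2 : ℂ)) z :=
    (Complex.ofRealCLM.contDiff.comp (h.contDiff_real.comp contDiff_snd)).contDiffAt
  simp_rw [div_eq_mul_inv]
  exact (h1.mul (h2.inv (by exact_mod_cast hd _ hz))).of_le (by norm_num)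

include h in
lemma quotient_zero {x : ι → ℝ} (hx : d x ≠ 0) :
    δ (complexHomotopy P (0, x)) / (d x : ℂ) = 1 := by
  have h1 : complexHomotopy P (0, x) = cx x := by simp [complexHomotopy]
  rw [h1, h.apply_cx, div_self]
  exact_mod_cast hx

include h hCo hP hd hδ

lemma contDiffAt_homotopyWeight {z : ℝ × (ι → ℝ)} (hz : z.2 ∈ C) :
    ContDiffAt ℝ 1 (homotopyWeight κ δ d P) z := by
  have h1 := contDiffAt_logLift hCo (fun z hz => contDiffAt_quotient h hP hd hz)
    (fun z hz => div_ne_zero (hδ z hz) (by exact_mod_cast hd _ hz))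
    (fun x hx => quotient_zero h (hd x hx)) hz
  have h2 : ContDiffAt ℝ 1 (fun z : ℝ × (ι → ℝ) => Real.log (d z.2)) z :=
    (((h.contDiff_real.comp contDiff_snd).contDiffAt (x := z)).log (hd _ hz)).of_le (by norm_num)
  have h3 : ContDiffAt ℝ 1 (fun z : ℝ × (ι → ℝ) => (Real.log (d z.2) : ℂ)) z :=
    Complex.ofRealCLM.contDiff.contDiffAt.comp z h2
  exact (contDiffAt_const.mul (h3.add h1)).cexp

lemma fderiv_homotopyWeight {z : ℝ × (ι → ℝ)} (hz : z.2 ∈ C) (v : ℝ × (ι → ℝ)) :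
    fderiv ℝ (homotopyWeight κ δ d P) z v = -κ * homotopyWeight κ δ d P z *
      (fderiv ℂ δ (complexHomotopy P z) (fderiv ℝ (complexHomotopy P) z v) /
        δ (complexHomotopy P z)) := by
  set g : ℝ × (ι → ℝ) → ℂ := fun z => δ (complexHomotopy P z) / (d z.2 : ℂ) with hg
  have hdz : (d z.2 : ℂ) ≠ 0 := by exact_mod_cast hd _ hz
  have hδz := hδ z hz
  have hl := ((contDiffAt_logLift hCo (fun z hz => contDiffAt_quotient h hP hd hz)
    (fun z hz => div_ne_zero (hδ z hz) (by exact_mod_cast hd _ hz))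
    (fun x hx => quotient_zero h (hd x hx)) hz).differentiableAt (by norm_num)).hasFDerivAt
  have hl2 := fderiv_logLift hCo (fun z hz => contDiffAt_quotient h hP hd hz)
    (fun z hz => div_ne_zero (hδ z hz) (by exact_mod_cast hd _ hz))
    (fun x hx => quotient_zero h (hd x hx)) hz v
  change g z * _ = fderiv ℝ g z v at hl2
  have hdd : HasFDerivAt (fun z : ℝ × (ι → ℝ) => d z.2)
      ((fderiv ℝ d z.2).comp (ContinuousLinearMap.snd ℝ ℝ (ι → ℝ))) z :=
    HasFDerivAt.comp z (h.contDiff_real.differentiable (by norm_num) z.2).hasFDerivAt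
      hasFDerivAt_snd
  have hdc := Complex.ofRealCLM.hasFDerivAt.comp z hdd
  have hlog := Complex.ofRealCLM.hasFDerivAt.comp z (hdd.log (hd _ hz))
  have hw := ((hlog.add hl).const_mul (-κ : ℂ)).cexp
  have hF := ((contDiffAt_complexHomotopy hP hz).differentiableAt (by norm_num)).hasFDerivAt
  have hδF :=
    ((h.contDiff.differentiable (by norm_num) (complexHomotopy P z)).hasFDerivAt.restrictScalars
      ℝ).comp z hF
  have hgd : HasFDerivAt (fun z => g z * (d z.2 : ℂ)) _ z :=
    (((contDiffAt_quotient h hP hd hz).differentiableAt (by norm_num)).hasFDerivAt).fun_mul hdc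
  have hev : (fun z => g z * (d z.2 : ℂ)) =ᶠ[𝓝 z] fun z => δ (complexHomotopy P z) := by
    filter_upwards [(hCo.preimage continuous_snd).mem_nhds hz] with y hy
    exact div_mul_cancel₀ _ (by exact_mod_cast hd _ hy)
  have huniq := DFunLike.congr_fun (hgd.unique (hδF.congr_of_eventuallyEq hev)) v
  have hwv := DFunLike.congr_fun (hw.fderiv) v
  have hgz : g z = δ (complexHomotopy P z) / (d z.2 : ℂ) := rfl
  refine Eq.trans hwv ?_
  change g z * (fderiv ℝ d z.2 v.2 : ℂ) + (d z.2 : ℂ) * fderiv ℝ g z v =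
    fderiv ℂ δ (complexHomotopy P z) (fderiv ℝ (complexHomotopy P) z v) at huniq
  change homotopyWeight κ δ d P z * (-κ * ((((d z.2)⁻¹ * fderiv ℝ d z.2 v.2 : ℝ) : ℂ) +
    fderiv ℝ (logLift g) z v)) = _
  change g z * fderiv ℝ (logLift g) z v = _ at hl2
  rw [← huniq, ← hl2, hgz]
  generalize fderiv ℝ (logLift g) z v = B
  push_cast
  field_simp

end FirstHomotopy

section Nonvanishing

open MeasureTheory Topology

variable {ι : Type*} [Fintype ι] [DecidableEq ι] {Λ : Type*} [Group Λ]
  {ρ : Λ →* Matrix ι ι ℝ} {χ : Λ → ℝ} {κ : ℝ} {δ : (ι → ℂ) → ℂ} {d : (ι → ℝ) → ℝ}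
  {C : Set (ι → ℝ)} {P : (ι → ℝ) → ι → ℝ}

lemma homotopyWeight_equivariant (h : RelInvariant ρ χ κ δ d)
    (hPρ : ∀ l, ∀ x ∈ C, P (ρ l *ᵥ x) = ρ l *ᵥ P x) (hd : ∀ x ∈ C, d x ≠ 0) (l : Λ) (t : ℝ)
    {x : ι → ℝ} (hx : x ∈ C) :
    |(ρ l).det| • homotopyWeight κ δ d P (t, ρ l *ᵥ x) = homotopyWeight κ δ d P (t, x) := by
  have hχ : (χ l : ℂ) ≠ 0 := by exact_mod_cast (h.pos l).ne'
  have h1 : logLift (fun z => δ (complexHomotopy P z) / d z.2) (t, ρ l *ᵥ x) =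
      logLift (fun z => δ (complexHomotopy P z) / d z.2) (t, x) := by
    refine logLift_congr (fun s => ?_) t
    simp only
    rw [complexHomotopy_equivariant hPρ l s hx, h.apply_mulVec, h.apply_real_mulVec]
    push_cast
    exact mul_div_mul_left _ _ hχ
  simp only [homotopyWeight]
  rw [h1, h.apply_real_mulVec, Real.log_mul (h.pos l).ne' (hd x hx), h.abs_det, Complex.real_smul,
    Complex.ofReal_exp, ← Complex.exp_add]
  congr 1
  push_cast
  ring

lemma integral_homotopy_one_ne_zero (h : RelInvariant ρ χ κ δ d) (hC : ProperOn ρ C)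
    (hP : ∀ x ∈ C, ContDiffAt ℝ 2 P x) (hPρ : ∀ l, ∀ x ∈ C, P (ρ l *ᵥ x) = ρ l *ᵥ P x)
    (hd : ∀ x ∈ C, d x ≠ 0) (hδ : ∀ z : ℝ × (ι → ℝ), z.2 ∈ C → δ (complexHomotopy P z) ≠ 0)
    {φ : (ι → ℝ) → ℝ} (hφ : ContDiff ℝ 1 φ) (hφc : HasCompactSupport φ) (hφC : tsupport φ ⊆ C)
    (hφ0 : ∀ x, 0 ≤ φ x) (hsum : ∀ x ∈ C, ∑ᶠ l, φ (ρ l *ᵥ x) = 1) (hne : C.Nonempty) :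
    ∫ x, φ x • pullbackDensity (complexHomotopy P) (homotopyWeight κ δ d P) (1, x) ≠ 0 := by
  have hf : ∀ z : ℝ × (ι → ℝ), z.2 ∈ C → ContDiffAt ℝ 2 (complexHomotopy P) z := fun z hz =>
    contDiffAt_complexHomotopy hP hz
  have hw : ∀ z : ℝ × (ι → ℝ), z.2 ∈ C → ContDiffAt ℝ 1 (homotopyWeight κ δ d P) z :=
    fun z hz => contDiffAt_homotopyWeight h hC.isOpen hP hd hδ hz
  rw [integral_pullbackDensity_homotopy hf hw ?_ hφ hφc hφC ?_]
  · have h0 : ∀ x, φ x • pullbackDensity (complexHomotopy P) (homotopyWeight κ δ d P) (0, x) =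
        ((φ x * Real.exp (-κ * Real.log (d x)) : ℝ) : ℂ) := by
      intro x
      by_cases hx : x ∈ C
      · have h1 : ∀ i, fderiv ℝ (complexHomotopy P) (0, x) (0, Pi.single i 1) =
            Pi.single i 1 := by
          intro i
          have h2 := (hf (0, x) hx).differentiableAt (by norm_num)
          have h3 : HasFDerivAt (fun y : ι → ℝ => complexHomotopy P (0, y))
              ((fderiv ℝ (complexHomotopy P) (0, x)).comp
                (ContinuousLinearMap.inr ℝ ℝ (ι → ℝ))) x :=
            h2.hasFDerivAt.comp x (hasFDerivAt_prodMk_right 0 x)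
          have h4 : (fun y : ι → ℝ => complexHomotopy P (0, y)) = fun y => cx y := by
            funext y; simp [complexHomotopy]
          rw [h4] at h3
          have h5 := DFunLike.congr_fun (h3.unique (cx (ι := ι)).hasFDerivAt) (Pi.single i 1)
          refine Eq.trans h5 ?_
          funext j
          by_cases hij : j = i
          · subst hij; simp [cx_apply]
          · simp [cx_apply, hij]
        have h2 : rowDet ι (fun i =>
            fderiv ℝ (complexHomotopy P) (0, x) (0, Pi.single i 1)) = 1 := by
          rw [rowDet_apply]
          have : (Matrix.of fun i => fderiv ℝ (complexHomotopy P) (0, x) (0, Pi.single i 1)) =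
              (1 : Matrix ι ι ℂ) := by
            ext i j
            rw [Matrix.of_apply, h1, Matrix.one_apply, Pi.single_apply]
            simp [eq_comm]
          rw [this, det_one]
        rw [pullbackDensity, h2, homotopyWeight, logLift_zero]
        simp
      · have : φ x = 0 := image_eq_zero_of_notMem_tsupport fun h => hx (hφC h)
        simp [this]
    simp_rw [h0]
    rw [integral_complex_ofReal]
    norm_cast
    refine ne_of_gt ?_
    have hts : tsupport (fun x => φ x * Real.exp (-κ * Real.log (d x))) ⊆ tsupport φ :=
      closure_mono fun x hx h0 => hx (by simp [h0])
    obtain ⟨x, hx⟩ := hne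
    obtain ⟨l, hl⟩ : ∃ l, φ (ρ l *ᵥ x) ≠ 0 := by
      by_contra! hc
      have := hsum x hx
      simp [hc] at this
    refine Continuous.integral_pos_of_hasCompactSupport_nonneg_nonzero (x := ρ l *ᵥ x) ?_
      (hφc.of_isClosed_subset (isClosed_tsupport _) hts)
      (fun y => mul_nonneg (hφ0 y) (Real.exp_pos _).le)
      (mul_ne_zero hl (Real.exp_pos _).ne')
    refine continuous_of_tsupport fun y hy => ?_
    exact hφ.continuous.continuousAt.mul (Real.continuous_exp.continuousAt.comp
      (continuousAt_const.mul (h.contDiff_real.continuous.continuousAt.log (hd y (hφC (hts hy))))))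
  · intro z hz
    refine ⟨(-κ * homotopyWeight κ δ d P z / δ (complexHomotopy P z)) •
      (fderiv ℂ δ (complexHomotopy P z)).toLinearMap, fun v => ?_⟩
    rw [fderiv_homotopyWeight h hC.isOpen hP hd hδ hz]
    simp
    ring
  · intro t _
    refine integral_flux_eq_zero (ρ := ρ) (Y := fun x j => transgression (complexHomotopy P)
      (homotopyWeight κ δ d P) j (t, x)) hC.finite hφ hφc hφC hsum (fun x hx => ?_)
      fun l x hx j => ?_
    · refine continuousAt_pi.2 fun j => ?_
      exact (contDiffAt_transgression (hf (t, x) hx) (hw (t, x) hx) j).continuousAt.comp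
        (f := fun x => (t, x)) (by fun_prop)
    · exact transgression_equivariant hC.isOpen _ (det_map_ne_zero ρ l)
        (fun z hz => (hf z hz).differentiableAt (by norm_num)) (hC.mulVec_mem l)
        (fun t x hx => complexHomotopy_equivariant hPρ l t hx)
        (fun t x hx => homotopyWeight_equivariant h hPρ hd l t hx) t hx j

end Nonvanishing

section Displacement

open MeasureTheory Topology

variable {ι : Type*} [Fintype ι] [DecidableEq ι] {C : Set (ι → ℝ)} {P : (ι → ℝ) → ι → ℝ}

/-- A real linear form, extended complex linearly and precomposed with multiplication by `-i`. -/
def rotatedForm (L : (ι → ℝ) →L[ℝ] ℝ) : (ι → ℂ) →ₗ[ℂ] ℂ :=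
  ∑ i, (-Complex.I * (L (Pi.single i 1) : ℂ)) • LinearMap.proj i

lemma rotatedForm_apply (L : (ι → ℝ) →L[ℝ] ℝ) (y : ι → ℝ) :
    rotatedForm L (Complex.I • cx y) = (L y : ℂ) := by
  have h1 : L y = ∑ i, y i * L (Pi.single i 1) := by
    conv_lhs => rw [pi_eq_sum_univ' y]
    simp [map_sum, map_smul]
  rw [h1, rotatedForm, LinearMap.sum_apply]
  push_cast
  refine Finset.sum_congr rfl fun i _ => ?_
  simp only [LinearMap.smul_apply, LinearMap.proj_apply, Pi.smul_apply, cx_apply, smul_eq_mul]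
  linear_combination (-(L (Pi.single i 1) : ℂ) * (y i : ℂ)) * Complex.I_mul_I

lemma integral_pullbackDensity_displacement
    (hP : ∀ x ∈ C, ContDiffAt ℝ 2 P x) {b : (ι → ℝ) → ℝ} (hb : ContDiff ℝ 2 b)
    {c : (ι → ℝ) → ℂ} (hc : ∀ x ∈ C, ContDiffAt ℝ 1 c x) (hc0 : ∀ x ∈ C, fderiv ℝ c x = 0)
    {v : ι → ℝ} (hv : ∀ y ∈ tsupport b, y + v ∉ P '' C)
    {ψ : (ι → ℝ) → ℝ} (hψ : ContDiff ℝ 1 ψ) (hψc : HasCompactSupport ψ) (hψC : tsupport ψ ⊆ C)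
    (hψ1 : ∀ x ∈ C, ∀ s ∈ Set.Icc (0 : ℝ) 1, P x - s • v ∈ tsupport b → ∀ᶠ y in 𝓝 x, ψ y = 1) :
    ∫ x, ψ x • pullbackDensity (fun z => Complex.I • cx (P z.2 - z.1 • v))
      (fun z => c z.2 * (b (P z.2 - z.1 • v) : ℂ)) (0, x) = 0 := by
  set g : ℝ × (ι → ℝ) → ι → ℝ := fun z => P z.2 - z.1 • v with hg
  have hgC : ∀ z : ℝ × (ι → ℝ), z.2 ∈ C → ContDiffAt ℝ 2 g z := fun z hz =>
    ((hP _ hz).comp z contDiffAt_snd).sub (contDiffAt_fst.smul contDiffAt_const)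
  have hf : ∀ z : ℝ × (ι → ℝ), z.2 ∈ C → ContDiffAt ℝ 2 (fun z => Complex.I • cx (g z)) z :=
    fun z hz => (contDiff_cx.contDiffAt.comp z (hgC z hz)).const_smul Complex.I
  have hbz : ∀ z : ℝ × (ι → ℝ), z.2 ∈ C → ContDiffAt ℝ 1 (fun z => (b (g z) : ℂ)) z :=
    fun z hz => (Complex.ofRealCLM.contDiff.contDiffAt.comp z
      (hb.contDiffAt.comp z (hgC z hz))).of_le (by norm_num)
  have hw : ∀ z : ℝ × (ι → ℝ), z.2 ∈ C → ContDiffAt ℝ 1 (fun z => c z.2 * (b (g z) : ℂ)) z :=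
    fun z hz => ((hc _ hz).comp z contDiffAt_snd).mul (hbz z hz)
  have hzero : ∀ (s : ℝ) (x : ι → ℝ), b (P x - s • v) = 0 →
      (c x * (b (P x - s • v) : ℂ)) = 0 := by
    intro s x h; simp [h]
  rw [← integral_pullbackDensity_homotopy hf hw ?_ hψ hψc hψC ?_]
  · have : ∀ x, ψ x • pullbackDensity (fun z => Complex.I • cx (g z))
        (fun z => c z.2 * (b (g z) : ℂ)) (1, x) = 0 := by
      intro x
      by_cases hx : x ∈ C
      · have h0 : b (P x - (1 : ℝ) • v) = 0 := by
          by_contra h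
          exact hv _ (subset_tsupport b h) ⟨x, hx, by simp⟩
        simp only [pullbackDensity]
        rw [show (c x * (b (g (1, x)) : ℂ)) = 0 from hzero 1 x h0, zero_mul, smul_zero]
      · rw [image_eq_zero_of_notMem_tsupport fun h => hx (hψC h), zero_smul]
    simp_rw [this]
    simp
  · intro z hz
    have hgd := ((hgC z hz).differentiableAt (by norm_num)).hasFDerivAt
    have hF : HasFDerivAt (fun z => Complex.I • cx (g z)) _ z :=
      (((cx (ι := ι)).hasFDerivAt.comp z hgd).const_smul Complex.I)
    have hbd : HasFDerivAt (fun z => (b (g z) : ℂ)) _ z := Complex.ofRealCLM.hasFDerivAt.comp z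
      (((hb.differentiable (by norm_num) (g z)).hasFDerivAt).comp z hgd)
    have hcd : HasFDerivAt (fun z : ℝ × (ι → ℝ) => c z.2) _ z :=
      HasFDerivAt.comp z ((hc _ hz).differentiableAt (by norm_num)).hasFDerivAt hasFDerivAt_snd
    refine ⟨c z.2 • rotatedForm (fderiv ℝ b (g z)), fun u => ?_⟩
    rw [hF.fderiv, (hcd.fun_mul hbd).fderiv, hc0 _ hz]
    have := rotatedForm_apply (fderiv ℝ b (g z)) (fderiv ℝ g z u)
    simp only [_root_.add_apply, _root_.smul_apply,
      ContinuousLinearMap.comp_apply, _root_.zero_apply, smul_zero, add_zero,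
      LinearMap.smul_apply]
    rw [this]
    simp
  · intro t ht
    have : ∀ x, ∑ j, fderiv ℝ ψ x (Pi.single j 1) • transgression
        (fun z => Complex.I • cx (g z)) (fun z => c z.2 * (b (g z) : ℂ)) j (t, x) = 0 := by
      intro x
      refine Finset.sum_eq_zero fun j _ => ?_
      by_cases hx : x ∈ C
      · by_cases h0 : b (P x - t • v) = 0
        · simp only [transgression]
          rw [show (c x * (b (g (t, x)) : ℂ)) = 0 from hzero t x h0, zero_mul, smul_zero]
        · have h1 := hψ1 x hx t ht (subset_tsupport b h0)
          have h2 : fderiv ℝ ψ x = 0 := by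
            rw [Filter.EventuallyEq.fderiv_eq (f₁ := ψ) (f := fun _ => (1 : ℝ)) h1]; simp
          rw [h2]; simp
      · have h1 : ψ =ᶠ[𝓝 x] 0 := notMem_tsupport_iff_eventuallyEq.1 fun h => hx (hψC h)
        have h2 : fderiv ℝ ψ x = 0 := by rw [h1.fderiv_eq]; simp
        rw [h2]; simp
    simp_rw [this]
    simp

end Displacement

section Obstruction

open MeasureTheory Topology

variable {ι : Type*} [Fintype ι] [DecidableEq ι]

lemma fderiv_slice {E F : Type*} [NormedAddCommGroup E] [NormedSpace ℝ E] [NormedAddCommGroup F]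
    [NormedSpace ℝ F] {f : ℝ × E → F} {t : ℝ} {x : E} (hf : DifferentiableAt ℝ f (t, x)) (v : E) :
    fderiv ℝ f (t, x) (0, v) = fderiv ℝ (fun y => f (t, y)) x v := by
  have h : HasFDerivAt (fun y => f (t, y))
      ((fderiv ℝ f (t, x)).comp (ContinuousLinearMap.inr ℝ ℝ E)) x :=
    hf.hasFDerivAt.comp x (hasFDerivAt_prodMk_right t x)
  rw [h.fderiv]
  rfl

lemma pullbackDensity_slice {f : ℝ × (ι → ℝ) → ι → ℂ} (w : ℝ × (ι → ℝ) → ℂ) {t : ℝ} {x : ι → ℝ}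
    (hf : DifferentiableAt ℝ f (t, x)) : pullbackDensity f w (t, x) =
      w (t, x) * rowDet ι (fun i => fderiv ℝ (fun y => f (t, y)) x (Pi.single i 1)) := by
  simp_rw [pullbackDensity, fderiv_slice hf]

variable {Λ : Type*} [Group Λ] {ρ : Λ →* Matrix ι ι ℝ} {C Ω : Set (ι → ℝ)} {P : (ι → ℝ) → ι → ℝ}

lemma exists_displacement (hsmul : ∀ r : ℝ, 0 < r → ∀ x ∈ Ω, r • x ∈ Ω)
    (hCρ : ∀ l, ∀ x ∈ C, ρ l *ᵥ x ∈ C)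
    (hPρ : ∀ l, ∀ x ∈ C, P (ρ l *ᵥ x) = ρ l *ᵥ P x) {s : Λ}
    (hs : ρ s = (2 : ℝ) • (1 : Matrix ι ι ℝ)) {y₀ : ι → ℝ} (hy₀ : y₀ ∈ Ω)
    (hy : ∀ᶠ z in 𝓝 y₀, z ∉ P '' C) {K : Set (ι → ℝ)} (hK : IsCompact K) :
    ∃ v ∈ Ω, ∀ y ∈ K, y + v ∉ P '' C := by
  have hsk : ∀ k : ℕ, ρ (s ^ k) = (2 : ℝ) ^ k • (1 : Matrix ι ι ℝ) := fun k => by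
    rw [map_pow, hs, smul_pow, one_pow]
  obtain ⟨ε, hε, hball⟩ := Metric.eventually_nhds_iff.1 hy
  obtain ⟨M, hM⟩ := hK.isBounded.exists_norm_le
  obtain ⟨k, hk⟩ := pow_unbounded_of_one_lt (M / ε) (one_lt_two (α := ℝ))
  have h2 : (0 : ℝ) < 2 ^ k := by positivity
  refine ⟨(2 : ℝ) ^ k • y₀, hsmul _ h2 _ hy₀, ?_⟩
  rintro y hyK ⟨x, hx, hxy⟩
  have h3 : P (ρ (s ^ k)⁻¹ *ᵥ x) = y₀ + ((2 : ℝ) ^ k)⁻¹ • y := by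
    rw [hPρ _ _ hx, hxy]
    have h4 : y + (2 : ℝ) ^ k • y₀ = ρ (s ^ k) *ᵥ (y₀ + ((2 : ℝ) ^ k)⁻¹ • y) := by
      rw [hsk, smul_mulVec, one_mulVec, smul_add, smul_smul, mul_inv_cancel₀ h2.ne', one_smul,
        add_comm]
    rw [h4, inv_mulVec_mulVec]
  refine hball ?_ ⟨_, hCρ _ _ hx, h3⟩
  rw [dist_eq_norm, add_sub_cancel_left, norm_smul, norm_inv, Real.norm_of_nonneg h2.le]
  rw [div_lt_iff₀ hε] at hk
  rw [inv_mul_lt_iff₀ h2]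
  exact (hM y hyK).trans_lt hk

variable {χ : Λ → ℝ} {κ : ℝ} {δ : (ι → ℂ) → ℂ} {d : (ι → ℝ) → ℝ}

omit [DecidableEq ι] in
lemma fderiv_complexHomotopy_one {x v : ι → ℝ} (hP : ContDiffAt ℝ 2 P x) :
    fderiv ℝ (complexHomotopy P) (1, x) (0, v) = Complex.I • cx (fderiv ℝ P x v) := by
  rw [fderiv_slice ((contDiffAt_complexHomotopy (C := {x}) (by simpa using hP)
    (by simp)).differentiableAt (by norm_num))]
  have h1 : (fun y => complexHomotopy P (1, y)) = fun y => Complex.I • cx (P y) := by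
    funext y; simp [complexHomotopy]
  have h2 : HasFDerivAt (fun y => Complex.I • cx (P y)) _ x :=
    ((cx (ι := ι)).hasFDerivAt.comp x (hP.differentiableAt (by norm_num)).hasFDerivAt).const_smul
      Complex.I
  rw [h1, h2.fderiv]
  rfl

lemma RelInvariant.fderiv_I_smul (h : RelInvariant ρ χ κ δ d) {y : ι → ℝ}
    (hy : δ (Complex.I • cx y) ≠ 0) (v : ι → ℝ) :
    fderiv ℂ δ (Complex.I • cx y) (Complex.I • cx v) / δ (Complex.I • cx y) =
      ((fderiv ℝ d y v / d y : ℝ) : ℂ) := by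
  obtain ⟨u, hu⟩ := h.apply_I_smul
  have h1 : (fun y : ι → ℝ => δ (Complex.I • cx y)) = fun y => u * (d y : ℂ) := by
    funext y; rw [hu, h.apply_cx]
  have h2 : HasFDerivAt (fun y : ι → ℝ => δ (Complex.I • cx y)) _ y :=
    ((h.contDiff.differentiable (by norm_num) (Complex.I • cx y)).hasFDerivAt.restrictScalars
      ℝ).comp y ((cx (ι := ι)).hasFDerivAt.const_smul Complex.I)
  have h3 : HasFDerivAt (fun y : ι → ℝ => u * (d y : ℂ)) _ y :=
    (Complex.ofRealCLM.hasFDerivAt.comp y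
      (h.contDiff_real.differentiable (by norm_num) y).hasFDerivAt).const_mul u
  rw [h1] at h2
  have h4 := DFunLike.congr_fun (h2.unique h3) v
  change fderiv ℂ δ (Complex.I • cx y) (Complex.I • cx v) = u * (fderiv ℝ d y v : ℂ) at h4
  have h5 : δ (Complex.I • cx y) = u * (d y : ℂ) := congrFun h1 y
  rw [h5] at hy
  rw [h4, h5, mul_div_mul_left _ _ (left_ne_zero_of_mul hy)]
  push_cast
  rfl

/-- An open cone on which a group acts properly with compact quotient cannot be joined by
nondegenerate straight segments to a proper convex cone on which the action is not cocompact. -/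
theorem no_cocompact_of_nondegenerate (h : RelInvariant ρ χ κ δ d) (hC : ProperOn ρ C)
    (hΩ : ProperOn ρ Ω) (hadd : ∀ x ∈ Ω, ∀ y ∈ Ω, x + y ∈ Ω)
    (hsmul : ∀ r : ℝ, 0 < r → ∀ x ∈ Ω, r • x ∈ Ω) (hd : ∀ x ∈ C, d x ≠ 0) (hdΩ : ∀ x ∈ Ω, d x ≠ 0)
    (hδ : ∀ x ∈ C, ∀ y ∈ Ω, ∀ t : ℝ, δ ((1 - t) • cx x + t • (Complex.I • cx y)) ≠ 0)
    {s : Λ} (hs : ρ s = (2 : ℝ) • (1 : Matrix ι ι ℝ))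
    (hnc : ∀ K ⊆ Ω, IsCompact K → ∃ y ∈ Ω, ∀ l, ρ l *ᵥ y ∉ K) (hne : C.Nonempty)
    {D : Set (ι → ℝ)} (hD : IsCompact D) (hDC : D ⊆ C) :
    ¬ ∀ x ∈ C, ∃ l, ρ l *ᵥ x ∈ D := by
  intro hcov
  have hΩne : Ω.Nonempty := by
    obtain ⟨y, hy, -⟩ := hnc ∅ (by simp) isCompact_empty
    exact ⟨y, hy⟩
  obtain ⟨P, hP, hPΩ, hPρ⟩ := exists_equivariant_map hC hΩ.mulVec_mem hadd hsmul hD hDC hcov hΩne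
  have hPc : ContinuousOn P C := fun x hx => (hP x hx).continuousAt.continuousWithinAt
  have hproper : ∀ K ⊆ Ω, IsCompact K → IsCompact (C ∩ P ⁻¹' K) := fun K hKΩ hK =>
    isCompact_inter_preimage hC hΩ hD hDC hcov hPc hPΩ hPρ hK hKΩ
  have hPD : IsCompact (P '' D) := hD.image_of_continuousOn (hPc.mono hDC)
  have hPDΩ : P '' D ⊆ Ω := by rintro _ ⟨x, hx, rfl⟩; exact hPΩ x (hDC hx)
  obtain ⟨β, hβ, hβc, hβΩ, hβ0, hβ1⟩ := exists_normalized_cutoff hΩ hPD hPDΩ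
  obtain ⟨hφ, hφc, hφC⟩ := indicator_comp_contDiff hC.isOpen hP hproper hβ hβc hβΩ
  set φ : (ι → ℝ) → ℝ := C.indicator fun x => β (P x) with hφdef
  have hφx : ∀ x ∈ C, φ x = β (P x) := fun x hx => Set.indicator_of_mem hx _
  have hφ0 : ∀ x, 0 ≤ φ x := fun x => Set.indicator_nonneg (fun x _ => hβ0 _) x
  have hδF : ∀ z : ℝ × (ι → ℝ), z.2 ∈ C → δ (complexHomotopy P z) ≠ 0 := fun z hz =>
    hδ _ hz _ (hPΩ _ hz) _
  have hsum : ∀ x ∈ C, ∑ᶠ l, φ (ρ l *ᵥ x) = 1 := by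
    intro x hx
    obtain ⟨l₀, hl₀⟩ := hcov x hx
    have h1 := hβ1 l₀⁻¹ _ ⟨_, hl₀, rfl⟩
    rw [hPρ _ _ hx, inv_mulVec_mulVec] at h1
    rw [← h1, orbitSum]
    refine finsum_congr fun l => ?_
    rw [hφx _ (hC.mulVec_mem l x hx), hPρ l x hx, smul_eq_mul, mul_one]
  set w := homotopyWeight κ δ d P with hwdef
  refine integral_homotopy_one_ne_zero h hC hP hPρ hd hδF (hφ.of_le (by norm_num)) hφc hφC hφ0 hsum
    hne ?_
  have hw : ∀ z : ℝ × (ι → ℝ), z.2 ∈ C → ContDiffAt ℝ 1 w z :=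
    fun z hz => contDiffAt_homotopyWeight h hC.isOpen hP hd hδF hz
  set e : (ι → ℝ) → ℝ := fun y => Real.exp (κ * Real.log (d y)) with he
  have hed : ∀ y ∈ Ω, ContDiffAt ℝ 2 e y := fun y hy =>
    (contDiffAt_const.mul (h.contDiff_real.contDiffAt.log (hdΩ y hy))).exp
  have hepos : ∀ y, 0 < e y := fun y => Real.exp_pos _
  -- the two factors of the weight at time one
  set b : (ι → ℝ) → ℝ := fun y => β y * (e y)⁻¹ with hb
  set c : (ι → ℝ) → ℂ := fun x => w (1, x) * (e (P x) : ℂ) with hc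
  have hbts : tsupport b ⊆ tsupport β := closure_mono fun y hy h0 => hy (by simp [hb, h0])
  have hbs : ContDiff ℝ 2 b := contDiff_of_tsupport_contDiffAt fun y hy =>
    hβ.contDiffAt.mul ((hed y (hβΩ (hbts hy))).inv (hepos y).ne')
  have hbc : HasCompactSupport b := hβc.of_isClosed_subset (isClosed_tsupport _) hbts
  have hcC : ∀ x ∈ C, ContDiffAt ℝ 1 c x := fun x hx =>
    ((hw (1, x) hx).comp x (contDiffAt_const.prodMk contDiffAt_id)).mul
      ((Complex.ofRealCLM.contDiff.contDiffAt.comp x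
        ((hed _ (hPΩ x hx)).comp x (hP x hx))).of_le (by norm_num))
  have hc0 : ∀ x ∈ C, fderiv ℝ c x = 0 := by
    intro x hx
    have h1 : HasFDerivAt (fun x => w (1, x)) _ x := HasFDerivAt.comp (g := w) x
      ((hw (1, x) hx).differentiableAt (by norm_num)).hasFDerivAt (hasFDerivAt_prodMk_right 1 x)
    have h2 : HasFDerivAt (fun x => d (P x)) _ x := HasFDerivAt.comp x
      (h.contDiff_real.differentiable (by norm_num) (P x)).hasFDerivAt
      ((hP x hx).differentiableAt (by norm_num)).hasFDerivAt
    have h3 := ((h2.log (hdΩ _ (hPΩ x hx))).const_mul κ).exp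
    have h4 : HasFDerivAt (fun x => (e (P x) : ℂ)) _ x := Complex.ofRealCLM.hasFDerivAt.comp x h3
    ext v
    rw [(h1.fun_mul h4).fderiv]
    have h5 := fderiv_homotopyWeight h hC.isOpen hP hd hδF (z := (1, x)) hx (0, v)
    have h6 : complexHomotopy P (1, x) = Complex.I • cx (P x) := by simp [complexHomotopy]
    have h7 := hδF (1, x) hx
    rw [h6] at h7
    rw [fderiv_complexHomotopy_one (hP x hx), h6, h.fderiv_I_smul h7] at h5
    change w (1, x) * ((e (P x) * (κ * ((d (P x))⁻¹ * fderiv ℝ d (P x) (fderiv ℝ P x v))) : ℝ) : ℂ)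
      + (e (P x) : ℂ) * fderiv ℝ w (1, x) (0, v) = 0
    rw [h5]
    push_cast
    ring
  obtain ⟨y₀, hy₀, hy₀K⟩ := hnc _ hPDΩ hPD
  have hy₀P : y₀ ∉ P '' C := by
    rintro ⟨x, hx, rfl⟩
    obtain ⟨l, hl⟩ := hcov x hx
    exact hy₀K l ⟨_, hl, hPρ l x hx⟩
  obtain ⟨v, hvΩ, hv⟩ := exists_displacement hsmul hC.mulVec_mem hPρ hs hy₀
    (eventually_notMem_image hproper hΩ.isOpen hPc hy₀ hy₀P) hbc
  set K : Set (ι → ℝ) := (fun z : (ι → ℝ) × ℝ => z.1 + z.2 • v) '' (tsupport b ×ˢ Set.Icc 0 1)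
    with hKdef
  have hK : IsCompact K := (hbc.prod isCompact_Icc).image (by fun_prop)
  have hKΩ : K ⊆ Ω := by
    rintro _ ⟨⟨y, t⟩, ⟨hy, ht⟩, rfl⟩
    have hyΩ := hβΩ (hbts hy)
    rcases ht.1.eq_or_lt with h0 | h0
    · simpa [show t = 0 from h0.symm] using hyΩ
    · exact hadd _ hyΩ _ (hsmul t h0 _ hvΩ)
  obtain ⟨ψ, hψ, hψc, hψC, -, hψ1⟩ := exists_smooth_cutoff (hproper K hKΩ hK) hC.isOpen
    Set.inter_subset_left
  have hψ1' : ∀ x ∈ C, ∀ t ∈ Set.Icc (0 : ℝ) 1, P x - t • v ∈ tsupport b →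
      ∀ᶠ y in 𝓝 x, ψ y = 1 := fun x hx t ht hb =>
    hψ1 x ⟨hx, (P x - t • v, t), ⟨hb, ht⟩, by simp⟩
  rw [← integral_pullbackDensity_displacement hP hbs hcC hc0 hv (hψ.of_le (by norm_num)) hψc hψC
    hψ1']
  refine integral_congr_ae (Filter.Eventually.of_forall fun x => ?_)
  by_cases hx : x ∈ C
  · have hdF := (contDiffAt_complexHomotopy hP (z := (1, x)) hx).differentiableAt (by norm_num)
    have hdG : DifferentiableAt ℝ (fun z : ℝ × (ι → ℝ) => Complex.I • cx (P z.2 - z.1 • v))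
        (0, x) := by
      refine ContDiffAt.differentiableAt (n := 2) ?_ (by norm_num)
      exact (contDiff_cx.contDiffAt.comp (0, x) (((hP x hx).comp (0, x) contDiffAt_snd).sub
        (contDiffAt_fst.smul contDiffAt_const))).const_smul Complex.I
    simp only
    rw [pullbackDensity_slice _ hdF, pullbackDensity_slice _ hdG]
    have h1 : (fun y => complexHomotopy P (1, y)) = fun y => Complex.I • cx (P y) := by
      funext y; simp [complexHomotopy]
    simp only [h1, zero_smul, sub_zero, hφx x hx]
    by_cases hβx : β (P x) = 0
    · simp [hb, hβx]
    · have h2 : ψ x = 1 := (hψ1' x hx 0 (by simp) (by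
        simpa using subset_tsupport b (mul_ne_zero hβx (inv_ne_zero (hepos _).ne')))).self_of_nhds
      rw [h2, one_smul, Complex.real_smul]
      have h3 : (e (P x) : ℂ) ≠ 0 := by exact_mod_cast (hepos _).ne'
      simp only [hb, hc, hwdef]
      push_cast
      field_simp
  · simp only
    rw [image_eq_zero_of_notMem_tsupport fun h => hx (hψC h), zero_smul,
      image_eq_zero_of_notMem_tsupport fun h => hx (hφC h), zero_smul]

end Obstruction

section HomDet

variable {m : Type*} [Fintype m] [DecidableEq m]

lemma abs_hom_eq_one_of_conj_inv (f : Matrix m m ℝ →* ℝ) {A B S : Matrix m m ℝ} (hS : S * S = 1)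
    (hAB : A * B = 1) (h : S * A = B * S) : |f A| = 1 := by
  have h1 : f S * f S = 1 := by rw [← map_mul, hS, map_one]
  have h2 : f A * f B = 1 := by rw [← map_mul, hAB, map_one]
  have h3 : f S * f A = f B * f S := by rw [← map_mul, ← map_mul, h]
  have h4 : f A = f B := by
    linear_combination f S * h3 + (f B - f A) * h1
  rw [← h4, ← abs_mul_abs_self] at h2
  nlinarith [abs_nonneg (f A)]

lemma abs_hom_eq_one_of_det_eq_one [Nontrivial m] (f : Matrix m m ℝ →* ℝ) {A : Matrix m m ℝ}
    (hA : A.det = 1) : |f A| = 1 := by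
  refine SpecialLinearGroup.diagonal_transvection_induction' (ι := m) (F := ℝ)
    (fun M => |f M.1| = 1) ⟨A, hA⟩ (fun i j hij c hc => ?_) (fun i j hij a => ?_)
    fun M N hM hN => ?_
  · rw [SpecialLinearGroup.diag2n_coe]
    refine abs_hom_eq_one_of_conj_inv f (S := (Equiv.swap i j).permMatrix ℝ)
      (B := diagonal fun k => if k = i then c⁻¹ else if k = j then c else 1) ?_ ?_ ?_
    · rw [← permMatrix_mul, Equiv.swap_mul_self, permMatrix_one]
    · rw [diagonal_mul_diagonal, ← diagonal_one]
      congr 1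
      funext k
      split_ifs <;> simp [hc]
    · rw [Equiv.Perm.permMatrix, PEquiv.toMatrix_toPEquiv_mul]
      ext k l
      rw [diagonal_mul, PEquiv.toMatrix_apply, submatrix_apply, diagonal_apply]
      simp only [id, Equiv.toPEquiv_apply, Option.mem_def, Option.some.injEq]
      rcases eq_or_ne k i with rfl | hk
      · simp [hij.symm]
      rcases eq_or_ne k j with rfl | hk'
      · simp [hij.symm]
      · simp [Equiv.swap_apply_of_ne_of_ne hk hk', hk, hk']
  · refine abs_hom_eq_one_of_conj_inv f (S := diagonal fun k => if k = i then -1 else 1)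
      (B := transvection i j (-a)) ?_ ?_ ?_
    · rw [diagonal_mul_diagonal, ← diagonal_one]
      congr 1
      funext k
      split_ifs <;> simp
    · change transvection i j a * _ = 1
      rw [transvection_mul_transvection_same _ _ hij, add_neg_cancel, transvection_zero]
    · rw [SpecialLinearGroup.transvection_coe, transvection, mul_add, add_mul, mul_one, one_mul]
      congr 1
      ext k l
      rw [diagonal_mul, mul_diagonal, single_apply, single_apply]
      by_cases h1 : i = k
      · by_cases h2 : j = l
        · subst h1 h2; simp [hij.symm]
        · simp [h2]
      · simp [h1]
  · change |f (M.1 * N.1)| = 1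
    rw [map_mul, abs_mul, hM, hN, one_mul]

end HomDet

section SymmetricMatrices

variable {m : Type*} [Fintype m] [DecidableEq m]

/-- The symmetric matrix with given entries. -/
def toSym {R : Type*} (x : Sym2 m → R) : Matrix m m R := of fun i j => x s(i, j)

omit [Fintype m] [DecidableEq m] in
lemma toSym_apply {R : Type*} (x : Sym2 m → R) (i j : m) : toSym x i j = x s(i, j) := rfl

omit [Fintype m] [DecidableEq m] in
lemma transpose_toSym {R : Type*} (x : Sym2 m → R) : (toSym x)ᵀ = toSym x := by
  ext i j
  rw [transpose_apply, toSym_apply, toSym_apply, Sym2.eq_swap]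

omit [Fintype m] [DecidableEq m] in
lemma toSym_injective {R : Type*} : Function.Injective (toSym : (Sym2 m → R) → Matrix m m R) := by
  intro x y h
  funext z
  induction z with
  | _ i j => exact congrFun (congrFun h i) j

/-- The entries of the symmetric part of a matrix. -/
def ofSym : Matrix m m ℝ →ₗ[ℝ] Sym2 m → ℝ where
  toFun A z := z.lift ⟨fun i j => (A i j + A j i) / 2, fun i j => by simp only [add_comm]⟩
  map_add' A B := by
    funext z
    induction z with
    | _ i j => simp; ring
  map_smul' r A := by
    funext z
    induction z with
    | _ i j => simp; ring

omit [Fintype m] [DecidableEq m] in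
lemma toSym_ofSym {A : Matrix m m ℝ} (hA : Aᵀ = A) : toSym (ofSym A) = A := by
  ext i j
  have h := congrFun (congrFun hA i) j
  rw [transpose_apply] at h
  simp [toSym_apply, ofSym, h]

/-- The linear map `S ↦ g S gᵀ` on symmetric matrices. -/
def symCongr (g : Matrix m m ℝ) : (Sym2 m → ℝ) →ₗ[ℝ] Sym2 m → ℝ where
  toFun x := ofSym (g * toSym x * gᵀ)
  map_add' x y := by
    rw [← map_add, ← add_mul, ← mul_add]
    rfl
  map_smul' r x := by
    rw [RingHom.id_apply, ← map_smul, ← smul_mul_assoc, ← mul_smul_comm]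
    rfl

lemma toSym_symCongr (g : Matrix m m ℝ) (x : Sym2 m → ℝ) :
    toSym (symCongr g x) = g * toSym x * gᵀ :=
  toSym_ofSym (by simp only [transpose_mul, transpose_transpose, transpose_toSym, Matrix.mul_assoc])

/-- The representation of matrices on symmetric matrices. -/
def symRep : Matrix m m ℝ →* Matrix (Sym2 m) (Sym2 m) ℝ where
  toFun g := LinearMap.toMatrix' (symCongr g)
  map_one' := by
    rw [← LinearMap.toMatrix'_one (n := Sym2 m)]
    congr 1
    refine LinearMap.ext fun x => toSym_injective ?_
    rw [toSym_symCongr, one_mul, transpose_one, mul_one, Module.End.one_apply]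
  map_mul' g h := by
    rw [← LinearMap.toMatrix'_mul]
    congr 1
    refine LinearMap.ext fun x => toSym_injective ?_
    rw [Module.End.mul_apply, toSym_symCongr, toSym_symCongr, toSym_symCongr]
    simp only [transpose_mul, Matrix.mul_assoc]

lemma toSym_symRep_mulVec (g : Matrix m m ℝ) (x : Sym2 m → ℝ) :
    toSym (symRep g *ᵥ x) = g * toSym x * gᵀ := by
  rw [← toSym_symCongr]
  congr 1
  exact LinearMap.toMatrix'_mulVec _ _

lemma toSym_complexify_symRep_mulVec (g : Matrix m m ℝ) (z : Sym2 m → ℂ) :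
    toSym (complexify (symRep g) *ᵥ z) = complexify g * toSym z * (complexify g)ᵀ := by
  have hcx : ∀ x : Sym2 m → ℝ, toSym (cx x) = complexify (toSym x) := fun x => by
    ext i j; simp [toSym_apply, cx_apply, complexify_apply]
  have hreal : ∀ x : Sym2 m → ℝ, toSym (complexify (symRep g) *ᵥ cx x) =
      complexify g * toSym (cx x) * (complexify g)ᵀ := fun x => by
    rw [← cx_mulVec, hcx, toSym_symRep_mulVec, hcx]
    ext i j
    simp [complexify_apply, mul_apply]
  have hz : z = cx (fun i => (z i).re) + Complex.I • cx (fun i => (z i).im) := by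
    funext i
    simp only [Pi.add_apply, Pi.smul_apply, cx_apply, smul_eq_mul]
    rw [mul_comm, Complex.re_add_im]
  have hadd : ∀ x y : Sym2 m → ℂ, toSym (x + y) = toSym x + toSym y := fun _ _ => rfl
  have hsmul : ∀ (c : ℂ) (x : Sym2 m → ℂ), toSym (c • x) = c • toSym x := fun _ _ => rfl
  rw [hz, mulVec_add, mulVec_smul, hadd, hsmul, hreal, hreal, hadd, hsmul]
  simp only [mul_add, add_mul, mul_smul_comm, smul_mul_assoc]

end SymmetricMatrices

section SymmetricCone

open Topology

variable {m : Type*} [Fintype m] [DecidableEq m]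

/-- The symmetric matrices congruent to `J`. -/
def symCone (J : Matrix m m ℝ) : Set (Sym2 m → ℝ) :=
  {x | ∃ g : Matrix m m ℝ, g.det ≠ 0 ∧ toSym x = g * J * gᵀ}

lemma symRep_mulVec_mem_symCone {J g : Matrix m m ℝ} (hg : g.det ≠ 0) {x : Sym2 m → ℝ}
    (hx : x ∈ symCone J) : symRep g *ᵥ x ∈ symCone J := by
  obtain ⟨a, ha, hxa⟩ := hx
  refine ⟨g * a, by rw [det_mul]; exact mul_ne_zero hg ha, ?_⟩
  rw [toSym_symRep_mulVec, hxa]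
  simp only [transpose_mul, Matrix.mul_assoc]

lemma smul_mem_symCone {J : Matrix m m ℝ} {r : ℝ} (hr : 0 < r) {x : Sym2 m → ℝ}
    (hx : x ∈ symCone J) : r • x ∈ symCone J := by
  obtain ⟨a, ha, hxa⟩ := hx
  refine ⟨√r • a, ?_, ?_⟩
  · rw [det_smul]
    exact mul_ne_zero (pow_ne_zero _ (Real.sqrt_pos.2 hr).ne') ha
  · change r • toSym x = _
    rw [hxa, transpose_smul, smul_mul_assoc, smul_mul_assoc, mul_smul_comm, smul_smul,
      Real.mul_self_sqrt hr.le]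

section Calculus

attribute [local instance] Matrix.normedAddCommGroup Matrix.normedSpace

lemma isOpen_image_ofSym {J : Matrix m m ℝ} (hJ : Jᵀ = J) (hJd : J.det ≠ 0)
    {U : Set (Matrix m m ℝ)} (hU : IsOpen U) (hdet : ∀ g ∈ U, g.det ≠ 0) :
    IsOpen ((fun g => ofSym (g * J * gᵀ)) '' U) := by
  let B : Matrix m m ℝ →ₗ[ℝ] Matrix m m ℝ →ₗ[ℝ] Sym2 m → ℝ :=
    LinearMap.mk₂ ℝ (fun a b => ofSym (a * J * bᵀ))
      (fun a a' b => by rw [← map_add, add_mul, add_mul])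
      (fun r a b => by rw [← map_smul, smul_mul_assoc, smul_mul_assoc])
      (fun a b b' => by rw [← map_add, transpose_add, mul_add])
      (fun r a b => by rw [← map_smul, transpose_smul, mul_smul_comm])
  rw [isOpen_iff_mem_nhds]
  rintro _ ⟨g, hg, rfl⟩
  have h1 := (B.toContinuousBilinearMap).hasStrictFDerivAt_of_bilinear
    (hasStrictFDerivAt_id g) (hasStrictFDerivAt_id g)
  have h2 := h1.map_nhds_eq_of_surj ?_
  · change Filter.map (fun g => ofSym (g * J * gᵀ)) (𝓝 g) = 𝓝 (ofSym (g * J * gᵀ)) at h2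
    simp only
    rw [← h2]
    exact Filter.image_mem_map (hU.mem_nhds hg)
  · rw [LinearMap.range_eq_top]
    intro x
    have hgu : IsUnit g.det := (hdet g hg).isUnit
    have hgt : IsUnit gᵀ.det := by rwa [det_transpose]
    set A : Matrix m m ℝ := (1 / 2 : ℝ) • (toSym x * gᵀ⁻¹ * J⁻¹) with hA
    have h3 : A * J * gᵀ = (1 / 2 : ℝ) • toSym x := by
      rw [hA, smul_mul_assoc, smul_mul_assoc, nonsing_inv_mul_cancel_right _ _ hJd.isUnit,
        nonsing_inv_mul_cancel_right _ _ hgt]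
    have h4 : g * J * Aᵀ = (1 / 2 : ℝ) • toSym x := by
      rw [← transpose_toSym x, ← transpose_smul, ← h3, transpose_mul, transpose_mul,
        transpose_transpose, hJ, Matrix.mul_assoc]
    refine ⟨A, ?_⟩
    change ofSym (g * J * Aᵀ) + ofSym (A * J * gᵀ) = x
    rw [← map_add, h3, h4, ← add_smul]
    norm_num
    exact toSym_injective (toSym_ofSym (transpose_toSym x))

end Calculus

omit [Fintype m] [DecidableEq m] in
lemma ofSym_eq_of_toSym_eq {x : Sym2 m → ℝ} {A : Matrix m m ℝ} (h : toSym x = A) :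
    ofSym A = x :=
  toSym_injective (by rw [toSym_ofSym (by rw [← h, transpose_toSym]), h])

omit [DecidableEq m] in
lemma transpose_congr {J : Matrix m m ℝ} (hJ : Jᵀ = J) (g : Matrix m m ℝ) :
    (g * J * gᵀ)ᵀ = g * J * gᵀ := by
  simp only [transpose_mul, transpose_transpose, hJ, Matrix.mul_assoc]

lemma image_ofSym_eq_symCone {J : Matrix m m ℝ} (hJ : Jᵀ = J) :
    (fun g => ofSym (g * J * gᵀ)) '' {g | g.det ≠ 0} = symCone J := by
  ext x
  constructor
  · rintro ⟨g, hg, rfl⟩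
    exact ⟨g, hg, toSym_ofSym (transpose_congr hJ g)⟩
  · rintro ⟨g, hg, hx⟩
    exact ⟨g, hg, ofSym_eq_of_toSym_eq hx⟩

lemma isOpen_symCone {J : Matrix m m ℝ} (hJ : Jᵀ = J) (hJd : J.det ≠ 0) :
    IsOpen (symCone J) := by
  rw [← image_ofSym_eq_symCone hJ]
  exact isOpen_image_ofSym hJ hJd (isOpen_ne.preimage (Continuous.matrix_det continuous_id))
    fun g hg => hg

lemma det_toSym_ne_zero {J : Matrix m m ℝ} (hJd : J.det ≠ 0) {x : Sym2 m → ℝ}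
    (hx : x ∈ symCone J) : (toSym x).det ≠ 0 := by
  obtain ⟨g, hg, h⟩ := hx
  rw [h, det_mul, det_mul, det_transpose]
  exact mul_ne_zero (mul_ne_zero hg hJd) hg

lemma exists_bounded_lift {J : Matrix m m ℝ} (hJ : Jᵀ = J) (hJd : J.det ≠ 0)
    {K : Set (Sym2 m → ℝ)} (hK : IsCompact K) (hKJ : K ⊆ symCone J) :
    ∃ R : ℝ, 1 ≤ R ∧ ∀ x ∈ K, ∃ g : Matrix m m ℝ, (∀ i j, |g i j| ≤ R) ∧ R⁻¹ < |g.det| ∧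
      toSym x = g * J * gᵀ := by
  set U : ℕ → Set (Matrix m m ℝ) := fun n =>
    {g | (∀ i j, |g i j| < (n : ℝ) + 1) ∧ ((n : ℝ) + 1)⁻¹ < |g.det|} with hUdef
  have hpos : ∀ n : ℕ, (0 : ℝ) < n + 1 := fun n => by positivity
  have hU : ∀ n, IsOpen (U n) := fun n => by
    refine IsOpen.inter (s := {g : Matrix m m ℝ | ∀ i j, |g i j| < (n : ℝ) + 1}) ?_ ?_
    · simp only [Set.ofPred_forall]
      exact isOpen_iInter_of_finite fun i => isOpen_iInter_of_finite fun j =>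
        isOpen_lt (continuous_id.matrix_elem i j).abs continuous_const
    · exact isOpen_lt continuous_const (Continuous.matrix_det continuous_id).abs
  have hUd : ∀ n, ∀ g ∈ U n, g.det ≠ 0 := fun n g hg h0 => by
    have := hg.2
    rw [h0, abs_zero] at this
    exact absurd this (not_lt.2 (inv_pos.2 (hpos n)).le)
  have hmono : Monotone fun n => (fun g => ofSym (g * J * gᵀ)) '' U n := by
    intro a b hab
    have h1 : (a : ℝ) + 1 ≤ b + 1 := by exact_mod_cast Nat.succ_le_succ hab
    exact Set.image_mono fun g hg => ⟨fun i j => (hg.1 i j).trans_le h1,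
      (inv_anti₀ (hpos a) h1).trans_lt hg.2⟩
  obtain ⟨n, hn⟩ := hK.elim_directed_cover (fun n => (fun g => ofSym (g * J * gᵀ)) '' U n)
    (fun n => isOpen_image_ofSym hJ hJd (hU n) (hUd n)) (fun x hx => by
      obtain ⟨g, hg, hxg⟩ := hKJ hx
      obtain ⟨n₁, hn₁⟩ := exists_nat_gt |g.det|⁻¹
      obtain ⟨n₂, hn₂⟩ := exists_nat_gt (∑ i, ∑ j, |g i j|)
      refine Set.mem_iUnion.2 ⟨n₁ + n₂, g, ⟨fun i j => ?_, ?_⟩, ofSym_eq_of_toSym_eq hxg⟩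
      · have h1 : |g i j| ≤ ∑ j, |g i j| :=
          Finset.single_le_sum (f := fun j => |g i j|) (fun _ _ => abs_nonneg _)
            (Finset.mem_univ j)
        have h2 : ∑ j, |g i j| ≤ ∑ i, ∑ j, |g i j| :=
          Finset.single_le_sum (f := fun i => ∑ j, |g i j|)
            (fun _ _ => Finset.sum_nonneg fun _ _ => abs_nonneg _) (Finset.mem_univ i)
        push_cast
        linarith [n₁.cast_nonneg (α := ℝ)]
      · refine inv_lt_of_inv_lt₀ (abs_pos.2 hg) ?_
        push_cast
        linarith [n₂.cast_nonneg (α := ℝ)]) hmono.directed_le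
  refine ⟨n + 1, by linarith [n.cast_nonneg (α := ℝ)], fun x hx => ?_⟩
  obtain ⟨g, hg, hgx⟩ := hn hx
  refine ⟨g, fun i j => (hg.1 i j).le, hg.2, ?_⟩
  rw [← hgx, toSym_ofSym (transpose_congr hJ g)]

lemma exists_unimodular_lift [Nonempty m] {w : m → ℝ} (hw : ∀ i, w i * w i = 1)
    {K : Set (Sym2 m → ℝ)} (hK : IsCompact K) (hKJ : K ⊆ symCone (diagonal w)) :
    ∃ R : ℝ, ∀ x ∈ K, ∃ g : Matrix m m ℝ, ∃ a : ℝ, 0 < a ∧ g.det = 1 ∧ (∀ i j, |g i j| ≤ R) ∧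
      toSym x = a • (g * diagonal w * gᵀ) := by
  have hwd : (diagonal w).det ≠ 0 := by
    rw [det_diagonal]
    exact Finset.prod_ne_zero_iff.2 fun i _ h => by simpa [h] using hw i
  obtain ⟨R, hR1, hR⟩ := exists_bounded_lift (diagonal_transpose w) hwd hK hKJ
  have hR0 : 0 < R := by linarith
  refine ⟨R * R, fun x hx => ?_⟩
  obtain ⟨g, hgR, hgd, hgx⟩ := hR x hx
  have hdet : 0 < |g.det| := (inv_pos.2 hR0).trans hgd
  have hn : Fintype.card m ≠ 0 := Fintype.card_ne_zero
  set c : ℝ := |g.det| ^ ((Fintype.card m : ℝ)⁻¹) with hc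
  have hc0 : 0 < c := Real.rpow_pos_of_pos hdet _
  have hcn : c ^ Fintype.card m = |g.det| := Real.rpow_inv_natCast_pow hdet.le hn
  obtain ⟨i₀⟩ := ‹Nonempty m›
  set e : ℝ := g.det / |g.det| with he
  have hee : e * e = 1 := by
    rw [he, div_mul_div_comm, ← abs_mul_abs_self g.det, div_self (mul_pos hdet hdet).ne']
  set r : m → ℝ := fun i => if i = i₀ then e else 1 with hr
  have hr2 : ∀ i, r i * r i = 1 := fun i => by
    simp only [hr]; split_ifs <;> simp [hee]
  have hrd : (diagonal r).det = e := by
    rw [det_diagonal, hr]; simp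
  refine ⟨c⁻¹ • (g * diagonal r), c * c, mul_pos hc0 hc0, ?_, fun i j => ?_, ?_⟩
  · rw [det_smul, det_mul, hrd, inv_pow, hcn, he]
    have : g.det * (g.det / |g.det|) = |g.det| := by
      rw [mul_div_assoc', ← abs_mul_abs_self g.det, mul_div_assoc, div_self hdet.ne', mul_one]
    rw [this, inv_mul_cancel₀ hdet.ne']
  · have h1 : |r j| = 1 := by
      have := hr2 j
      rw [← abs_mul_abs_self] at this
      nlinarith [abs_nonneg (r j)]
    have h2 : c⁻¹ ≤ R := by
      rcases le_total 1 c with h | h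
      · exact (inv_le_one_of_one_le₀ h).trans hR1
      · have h3 : c ^ Fintype.card m ≤ c := pow_le_of_le_one hc0.le h hn
        rw [hcn] at h3
        exact (inv_le_comm₀ hR0 hc0).1 (hgd.le.trans h3)
    rw [Matrix.smul_apply, mul_diagonal, smul_eq_mul, abs_mul, abs_mul, h1, mul_one,
      abs_of_pos (inv_pos.2 hc0)]
    exact mul_le_mul h2 (hgR i j) (abs_nonneg _) hR0.le
  · have h1 : diagonal r * diagonal w * diagonal r = diagonal w := by
      rw [diagonal_mul_diagonal, diagonal_mul_diagonal]
      congr 1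
      funext i
      linear_combination w i * hr2 i
    rw [transpose_smul, smul_mul_assoc, smul_mul_assoc, mul_smul_comm, smul_smul, smul_smul,
      show c * c * c⁻¹ * c⁻¹ = 1 by field_simp, one_smul, transpose_mul, diagonal_transpose, hgx]
    nth_rewrite 1 [← h1]
    simp only [Matrix.mul_assoc]

lemma exists_abs_det_bounds {J : Matrix m m ℝ} (hJd : J.det ≠ 0)
    {K : Set (Sym2 m → ℝ)} (hK : IsCompact K) (hKJ : K ⊆ symCone J) :
    ∃ R : ℝ, ∀ x ∈ K, |(toSym x).det| ≤ R ∧ |(toSym x).det|⁻¹ ≤ R := by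
  have h1 : Continuous fun x : Sym2 m → ℝ => (toSym x).det :=
    Continuous.matrix_det (continuous_matrix fun i j => continuous_apply _)
  obtain ⟨R₁, hR₁⟩ := hK.exists_bound_of_continuousOn h1.continuousOn
  obtain ⟨R₂, hR₂⟩ := hK.exists_bound_of_continuousOn
    (h1.continuousOn.inv₀ fun x hx => det_toSym_ne_zero hJd (hKJ hx))
  refine ⟨max R₁ R₂, fun x hx => ⟨(hR₁ x hx).trans (le_max_left _ _), ?_⟩⟩
  have := hR₂ x hx
  rw [Real.norm_eq_abs, Pi.inv_apply, abs_inv] at this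
  exact this.trans (le_max_right _ _)

lemma posDef_toSym_iff {x : Sym2 m → ℝ} :
    (toSym x).PosDef ↔ x ∈ symCone (diagonal fun _ => (1 : ℝ)) := by
  simp only [symCone, diagonal_one, mul_one, Set.mem_ofPred_eq]
  constructor
  · intro h
    obtain ⟨b, hb⟩ : ∃ b : Matrix m m ℝ, toSym x = star b * b := by
      open scoped MatrixOrder in
      exact CStarAlgebra.nonneg_iff_eq_star_mul_self.1 h.posSemidef.nonneg
    rw [star_eq_conjTranspose, conjTranspose_eq_transpose_of_trivial] at hb
    refine ⟨bᵀ, fun h0 => h.det_pos.ne' ?_, by rw [hb, transpose_transpose]⟩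
    rw [hb, det_mul, h0, zero_mul]
  · rintro ⟨g, hg, h⟩
    rw [h, ← conjTranspose_eq_transpose_of_trivial]
    refine PosDef.mul_conjTranspose_self g ?_
    rw [vecMul_injective_iff_isUnit, isUnit_iff_isUnit_det]
    exact hg.isUnit

lemma add_mem_symCone_one {x y : Sym2 m → ℝ}
    (hx : x ∈ symCone (diagonal fun _ => (1 : ℝ))) (hy : y ∈ symCone (diagonal fun _ => (1 : ℝ))) :
    x + y ∈ symCone (diagonal fun _ => (1 : ℝ)) := by
  rw [← posDef_toSym_iff] at hx hy ⊢
  exact hx.add hy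

end SymmetricCone

section DilationRepresentation

variable {m : Type*} [Fintype m] [DecidableEq m] {Γ : Type*} [Group Γ]

/-- The action of a matrix group on symmetric matrices, extended by the dilations by powers
of two. -/
def dilRep (f : Γ →* Matrix m m ℝ) :
    Γ × Multiplicative ℤ →* Matrix (Sym2 m) (Sym2 m) ℝ where
  toFun l := (2 : ℝ) ^ l.2.toAdd • symRep (f l.1)
  map_one' := by simp
  map_mul' l l' := by
    rw [Prod.fst_mul, Prod.snd_mul, toAdd_mul, zpow_add₀ two_ne_zero, map_mul, map_mul,
      smul_mul_smul_comm]

lemma toSym_dilRep_mulVec (f : Γ →* Matrix m m ℝ) (l : Γ × Multiplicative ℤ) (x : Sym2 m → ℝ) :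
    toSym (dilRep f l *ᵥ x) = (2 : ℝ) ^ l.2.toAdd • (f l.1 * toSym x * (f l.1)ᵀ) := by
  rw [← toSym_symRep_mulVec]
  change toSym (((2 : ℝ) ^ l.2.toAdd • symRep (f l.1)) *ᵥ x) = _
  rw [smul_mulVec]
  rfl

lemma dilRep_mulVec_mem_symCone {f : Γ →* Matrix m m ℝ} (hf : ∀ γ, (f γ).det = 1)
    {J : Matrix m m ℝ} (l : Γ × Multiplicative ℤ) {x : Sym2 m → ℝ} (hx : x ∈ symCone J) :
    dilRep f l *ᵥ x ∈ symCone J := by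
  change ((2 : ℝ) ^ l.2.toAdd • symRep (f l.1)) *ᵥ x ∈ _
  rw [smul_mulVec]
  exact smul_mem_symCone (zpow_pos two_pos _)
    (symRep_mulVec_mem_symCone (by rw [hf]; exact one_ne_zero) hx)

lemma contDiff_det_toSym : ContDiff ℂ 2 fun z : Sym2 m → ℂ => (toSym z).det := by
  simp only [det_apply', toSym_apply]
  fun_prop

lemma relInvariant_det [Nontrivial m] {f : Γ →* Matrix m m ℝ} (hf : ∀ γ, (f γ).det = 1) :
    RelInvariant (dilRep f) (fun l => ((2 : ℝ) ^ l.2.toAdd) ^ Fintype.card m)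
      (Fintype.card (Sym2 m) / Fintype.card m) (fun z => (toSym z).det)
      (fun x => (toSym x).det) where
  contDiff := contDiff_det_toSym
  apply_cx x := by
    rw [← det_complexify]
    rfl
  apply_I_smul := ⟨Complex.I ^ Fintype.card m, fun z => by
    rw [← det_smul]
    rfl⟩
  apply_mulVec l z := by
    have h1 : complexify (dilRep f l) =
        ((2 : ℝ) ^ l.2.toAdd : ℂ) • complexify (symRep (f l.1)) := by
      ext i j
      change (((2 : ℝ) ^ l.2.toAdd * symRep (f l.1) i j : ℝ) : ℂ) = _
      rw [Matrix.smul_apply, complexify_apply, smul_eq_mul]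
      push_cast
      rfl
    have h2 : toSym (complexify (dilRep f l) *ᵥ z) = ((2 : ℝ) ^ l.2.toAdd : ℂ) •
        (complexify (f l.1) * toSym z * (complexify (f l.1))ᵀ) := by
      rw [h1, smul_mulVec, ← toSym_complexify_symRep_mulVec]
      rfl
    rw [h2, det_smul, det_mul, det_mul, det_transpose, det_complexify, hf]
    push_cast
    ring
  pos l := by positivity
  abs_det l := by
    have hn : (Fintype.card m : ℝ) ≠ 0 := Nat.cast_ne_zero.2 Fintype.card_ne_zero
    have hc : (0 : ℝ) < (2 : ℝ) ^ l.2.toAdd := zpow_pos two_pos _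
    have h1 : |(symRep (f l.1)).det| = 1 :=
      abs_hom_eq_one_of_det_eq_one (Matrix.detMonoidHom.comp symRep) (hf l.1)
    change |((2 : ℝ) ^ l.2.toAdd • symRep (f l.1)).det| = _
    rw [det_smul, abs_mul, h1, mul_one, abs_of_pos (pow_pos hc _), Real.log_pow, ← mul_assoc,
      div_mul_cancel₀ _ hn, ← Real.log_pow, Real.exp_log (pow_pos hc _)]

lemma det_toSym_segment_ne_zero {x y : Sym2 m → ℝ} (hx : (toSym x).det ≠ 0)
    (hy : (toSym y).PosDef) (t : ℝ) :
    (toSym ((1 - t) • cx x + t • (Complex.I • cx y))).det ≠ 0 := by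
  intro h0
  obtain ⟨v, hv, hZ⟩ := exists_mulVec_eq_zero_iff.2 h0
  set a : m → ℝ := fun i => (v i).re with ha
  set b : m → ℝ := fun i => (v i).im with hb
  have hre : (1 - t) • (toSym x *ᵥ a) - t • (toSym y *ᵥ b) = 0 := by
    funext i
    have h := congrArg Complex.re (congrFun hZ i)
    simp only [mulVec, dotProduct, toSym_apply, Complex.re_sum, Pi.add_apply, Pi.smul_apply,
      cx_apply] at h
    simp only [mulVec, dotProduct, toSym_apply, Pi.sub_apply, Pi.smul_apply, Finset.smul_sum,
      ← Finset.sum_sub_distrib, ha, hb]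
    rw [Pi.zero_apply, Complex.zero_re] at h
    rw [Pi.zero_apply, ← h]
    refine Finset.sum_congr rfl fun j _ => ?_
    simp
    ring
  have him : (1 - t) • (toSym x *ᵥ b) + t • (toSym y *ᵥ a) = 0 := by
    funext i
    have h := congrArg Complex.im (congrFun hZ i)
    simp only [mulVec, dotProduct, toSym_apply, Complex.im_sum, Pi.add_apply, Pi.smul_apply,
      cx_apply] at h
    simp only [mulVec, dotProduct, toSym_apply, Pi.add_apply, Pi.smul_apply, Finset.smul_sum,
      ← Finset.sum_add_distrib, ha, hb]
    rw [Pi.zero_apply, Complex.zero_im] at h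
    rw [Pi.zero_apply, ← h]
    refine Finset.sum_congr rfl fun j _ => ?_
    simp
    ring
  have hsymm : b ⬝ᵥ (toSym x *ᵥ a) = a ⬝ᵥ (toSym x *ᵥ b) := by
    rw [dotProduct_mulVec, dotProduct_comm, ← mulVec_transpose, transpose_toSym]
  have hsum : t * (a ⬝ᵥ (toSym y *ᵥ a) + b ⬝ᵥ (toSym y *ᵥ b)) = 0 := by
    have h1 := congrArg (fun u => b ⬝ᵥ u) hre
    have h2 := congrArg (fun u => a ⬝ᵥ u) him
    simp only [dotProduct_sub, dotProduct_add, dotProduct_smul, dotProduct_zero, smul_eq_mul]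
      at h1 h2
    linear_combination h2 - h1 + (1 - t) * hsymm
  have hnn : ∀ u : m → ℝ, 0 ≤ u ⬝ᵥ (toSym y *ᵥ u) := fun u => by
    simpa using hy.posSemidef.dotProduct_mulVec_nonneg u
  have hpos : ∀ u : m → ℝ, u ≠ 0 → 0 < u ⬝ᵥ (toSym y *ᵥ u) := fun u hu => by
    simpa using hy.dotProduct_mulVec_pos hu
  have hab : a ≠ 0 ∨ b ≠ 0 := by
    by_contra! h
    exact hv (funext fun i => Complex.ext (congrFun h.1 i) (congrFun h.2 i))
  have ht : t = 0 := by
    refine (mul_eq_zero.1 hsum).resolve_right (ne_of_gt ?_)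
    rcases hab with h | h
    · exact add_pos_of_pos_of_nonneg (hpos a h) (hnn b)
    · exact add_pos_of_nonneg_of_pos (hnn a) (hpos b h)
  rw [ht] at hre him
  simp only [sub_zero, one_smul, zero_smul, add_zero] at hre him
  rcases hab with h | h
  · exact hx (exists_mulVec_eq_zero_iff.1 ⟨a, h, hre⟩)
  · exact hx (exists_mulVec_eq_zero_iff.1 ⟨b, h, him⟩)

end DilationRepresentation

section ReturnTimes

variable {m : Type*} [Fintype m] [DecidableEq m] {Γ : Type*} [Group Γ]

lemma le_of_two_zpow_pow_le {n N : ℕ} (hn : n ≠ 0) {B : ℝ} (hB : B < 2 ^ N) {k : ℤ}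
    (h : ((2 : ℝ) ^ k) ^ n ≤ B) : k ≤ N := by
  by_contra! hk
  have h1 : (2 : ℝ) ^ (N : ℤ) ≤ 2 ^ k := zpow_le_zpow_right₀ one_le_two hk.le
  have h2 : (1 : ℝ) ≤ 2 ^ k := one_le_zpow₀ one_le_two (by omega)
  have h3 := le_self_pow₀ h2 hn
  rw [zpow_natCast] at h1
  linarith

lemma exists_dilation_bound [Nonempty m] {f : Γ →* Matrix m m ℝ} (hf : ∀ γ, (f γ).det = 1)
    {J : Matrix m m ℝ} (hJ : J.det ≠ 0) {K : Set (Sym2 m → ℝ)} (hK : IsCompact K)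
    (hKJ : K ⊆ symCone J) :
    ∃ N : ℕ, ∀ l, ∀ x ∈ K, dilRep f l *ᵥ x ∈ K → l.2.toAdd ∈ Set.Icc (-N : ℤ) N := by
  obtain ⟨R, hR⟩ := exists_abs_det_bounds hJ hK hKJ
  obtain ⟨N, hN⟩ := pow_unbounded_of_one_lt (R * R) (one_lt_two (α := ℝ))
  have hn : Fintype.card m ≠ 0 := Fintype.card_ne_zero
  refine ⟨N, fun l x hx hlx => ?_⟩
  have hdx : 0 < |(toSym x).det| := abs_pos.2 (det_toSym_ne_zero hJ (hKJ hx))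
  have hdlx : 0 < |(toSym (dilRep f l *ᵥ x)).det| :=
    abs_pos.2 (det_toSym_ne_zero hJ (hKJ hlx))
  have hpos : (0 : ℝ) < ((2 : ℝ) ^ l.2.toAdd) ^ Fintype.card m := by positivity
  have hdet : |(toSym (dilRep f l *ᵥ x)).det| =
      ((2 : ℝ) ^ l.2.toAdd) ^ Fintype.card m * |(toSym x).det| := by
    rw [toSym_dilRep_mulVec, det_smul, det_mul, det_mul, det_transpose, hf, one_mul, mul_one,
      abs_mul, abs_of_pos hpos]
  have hR0 : 0 ≤ R := hdx.le.trans (hR x hx).1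
  have h1 : ((2 : ℝ) ^ l.2.toAdd) ^ Fintype.card m ≤ R * R := by
    rw [(eq_mul_inv_iff_mul_eq₀ hdx.ne').2 hdet.symm]
    exact mul_le_mul (hR _ hlx).1 (hR x hx).2 (inv_nonneg.2 hdx.le) hR0
  have h2 : ((2 : ℝ) ^ (-l.2.toAdd)) ^ Fintype.card m ≤ R * R := by
    rw [_root_.zpow_neg, inv_pow, (eq_mul_inv_iff_mul_eq₀ hdx.ne').2 hdet.symm,
      _root_.mul_inv_rev, inv_inv]
    exact mul_le_mul (hR x hx).1 (hR _ hlx).2 (inv_nonneg.2 hdlx.le) hR0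
  exact ⟨neg_le.1 (le_of_two_zpow_pow_le hn hN h2), le_of_two_zpow_pow_le hn hN h1⟩

lemma eq_of_smul_congr_eq [Nonempty m] {J g h : Matrix m m ℝ} (hJ : J.det ≠ 0)
    (hg : g.det = 1) (hh : h.det = 1) {a b : ℝ} (ha : 0 < a) (hb : 0 < b)
    (heq : a • (g * J * gᵀ) = b • (h * J * hᵀ)) : g * J * gᵀ = h * J * hᵀ := by
  have h1 := congrArg det heq
  simp only [det_smul, det_mul, det_transpose, hg, hh, one_mul, mul_one] at h1
  have h2 : a = b := (pow_left_inj₀ ha.le hb.le Fintype.card_ne_zero).1 (mul_right_cancel₀ hJ h1)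
  rw [h2] at heq
  exact smul_right_injective _ hb.ne' heq

lemma exists_congr_of_return [Nonempty m] {f : Γ →* Matrix m m ℝ} (hf : ∀ γ, (f γ).det = 1)
    {w : m → ℝ} (hw : ∀ i, w i * w i = 1) {K : Set (Sym2 m → ℝ)} (hK : IsCompact K)
    (hKJ : K ⊆ symCone (diagonal w)) :
    ∃ R : ℝ, ∀ l, ∀ x : Sym2 m → ℝ, dilRep f l *ᵥ x ∈ K → ∀ (g : Matrix m m ℝ) (a : ℝ), 0 < a →
      g.det = 1 → toSym x = a • (g * diagonal w * gᵀ) →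
      ∃ h : Matrix m m ℝ, h.det = 1 ∧ (∀ i j, |h i j| ≤ R) ∧
        f l.1 * g * diagonal w * (f l.1 * g)ᵀ = h * diagonal w * hᵀ := by
  have hwd : (diagonal w).det ≠ 0 := by
    rw [det_diagonal]
    exact Finset.prod_ne_zero_iff.2 fun i _ h => by simpa [h] using hw i
  obtain ⟨R, hR⟩ := exists_unimodular_lift hw hK hKJ
  refine ⟨R, fun l x hlx g a ha hg hx => ?_⟩
  obtain ⟨h, b, hb, hh, hhR, hhx⟩ := hR _ hlx
  refine ⟨h, hh, hhR, eq_of_smul_congr_eq hwd (by rw [det_mul, hf, hg, one_mul]) hh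
    (mul_pos (zpow_pos two_pos l.2.toAdd) ha) hb ?_⟩
  rw [← hhx, toSym_dilRep_mulVec, hx, mul_smul_comm, smul_mul_assoc, smul_smul, transpose_mul]
  simp only [Matrix.mul_assoc]

/-- Proper discontinuity of the action of the group extended by dilations, from a finiteness
statement for the group alone. -/
lemma properOn_symCone [Nonempty m] {f : Γ →* Matrix m m ℝ} (hf : ∀ γ, (f γ).det = 1)
    {w : m → ℝ} (hw : ∀ i, w i * w i = 1)
    (hfin : ∀ R : ℝ, {γ | ∃ g h : Matrix m m ℝ, g.det = 1 ∧ h.det = 1 ∧ (∀ i j, |g i j| ≤ R) ∧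
      (∀ i j, |h i j| ≤ R) ∧ f γ * g * diagonal w * (f γ * g)ᵀ = h * diagonal w * hᵀ}.Finite) :
    ProperOn (dilRep f) (symCone (diagonal w)) where
  isOpen := isOpen_symCone (diagonal_transpose w) (by
    rw [det_diagonal]
    exact Finset.prod_ne_zero_iff.2 fun i _ h => by simpa [h] using hw i)
  mulVec_mem l x hx := dilRep_mulVec_mem_symCone hf l hx
  finite K hKJ hK := by
    have hwd : (diagonal w).det ≠ 0 := by
      rw [det_diagonal]
      exact Finset.prod_ne_zero_iff.2 fun i _ h => by simpa [h] using hw i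
    obtain ⟨N, hN⟩ := exists_dilation_bound hf hwd hK hKJ
    obtain ⟨R₁, hR₁⟩ := exists_unimodular_lift hw hK hKJ
    obtain ⟨R₂, hR₂⟩ := exists_congr_of_return hf hw hK hKJ
    have hZ : (Multiplicative.toAdd ⁻¹' Set.Icc (-N : ℤ) N).Finite :=
      (Set.finite_Icc (-N : ℤ) N).preimage Multiplicative.toAdd.injective.injOn
    refine ((hfin (max R₁ R₂)).prod hZ).subset ?_
    rintro l ⟨x, hx, hlx⟩
    obtain ⟨g, a, ha, hg, hgR, hgx⟩ := hR₁ x hx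
    obtain ⟨h, hh, hhR, heq⟩ := hR₂ l x hlx g a ha hg hgx
    exact ⟨⟨g, h, hg, hh, fun i j => (hgR i j).trans (le_max_left _ _),
      fun i j => (hhR i j).trans (le_max_right _ _), heq⟩, hN l x hx hlx⟩

end ReturnTimes

section SpecialLinear

open Topology Pointwise

lemma isClosed_entries_le {m : Type*} [Fintype m] (R : ℝ) :
    IsClosed {A : Matrix m m ℝ | ∀ i j, |A i j| ≤ R} := by
  simp only [Set.ofPred_forall]
  exact isClosed_iInter fun i => isClosed_iInter fun j =>
    isClosed_le (continuous_id.matrix_elem i j).abs continuous_const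

lemma isCompact_unimodular_bounded {m : Type*} [Fintype m] [DecidableEq m] (R : ℝ) :
    IsCompact {A : Matrix m m ℝ | A.det = 1 ∧ ∀ i j, |A i j| ≤ R} :=
  (isCompact_univ_pi fun _ : m => isCompact_univ_pi fun _ : m =>
      isCompact_Icc (a := -R) (b := R)).of_isClosed_subset
    ((isClosed_eq (Continuous.matrix_det continuous_id) continuous_const).inter
      (isClosed_entries_le R)) fun _ hA i _ j _ => abs_le.1 (hA.2 i j)

lemma transpose_mul_diagonal_mul {m : Type*} [Fintype m] [DecidableEq m] {w : m → ℝ}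
    (hw : ∀ i, w i * w i = 1) {u : Matrix m m ℝ} (hu : u * diagonal w * uᵀ = diagonal w) :
    uᵀ * diagonal w * u = diagonal w := by
  have hww : diagonal w * diagonal w = 1 := by
    rw [diagonal_mul_diagonal, ← diagonal_one]
    exact congrArg diagonal (funext hw)
  have h1 : u * (diagonal w * uᵀ * diagonal w) = 1 := by
    rw [← Matrix.mul_assoc, ← Matrix.mul_assoc, hu, hww]
  have h2 := congrArg (diagonal w * ·) (mul_eq_one_comm.1 h1)
  simp only [mul_one, ← Matrix.mul_assoc, hww, one_mul] at h2
  exact h2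

variable {p q : ℕ}

variable (p q) in
/-- The tautological representation of the special linear group. -/
def slMat : ↥(SLpq p q) →* Matrix (Fin p ⊕ Fin q) (Fin p ⊕ Fin q) ℝ :=
  (Units.coeHom _).comp (SLpq p q).subtype

lemma det_slMat (g : ↥(SLpq p q)) : (slMat p q g).det = 1 := g.2

lemma continuous_slMat : Continuous (slMat p q) :=
  Units.continuous_val.comp continuous_subtype_val

lemma slMat_injective : Function.Injective (slMat p q) := fun _ _ h =>
  Subtype.ext (Units.ext h)

/-- The element of the special linear group with given matrix. -/
def slOf (A : Matrix (Fin p ⊕ Fin q) (Fin p ⊕ Fin q) ℝ) (hA : A.det = 1) : ↥(SLpq p q) :=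
  ⟨⟨A, A.adjugate, by rw [mul_adjugate, hA, one_smul], by rw [adjugate_mul, hA, one_smul]⟩, hA⟩

lemma slMat_slOf (A : Matrix (Fin p ⊕ Fin q) (Fin p ⊕ Fin q) ℝ) (hA : A.det = 1) :
    slMat p q (slOf A hA) = A := rfl

variable (p q) in
/-- The elements of the special linear group with entries bounded by `R`. -/
def slBall (R : ℝ) : Set ↥(SLpq p q) := {g | ∀ i j, |slMat p q g i j| ≤ R}

lemma isCompact_slBall (R : ℝ) : IsCompact (slBall p q R) := by
  have hc : Continuous fun A : {A : Matrix (Fin p ⊕ Fin q) (Fin p ⊕ Fin q) ℝ //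
      A.det = 1 ∧ ∀ i j, |A i j| ≤ R} => slOf A.1 A.2.1 := by
    refine Continuous.subtype_mk (Units.continuous_iff.2 ⟨continuous_subtype_val, ?_⟩) _
    exact continuous_subtype_val.matrix_adjugate
  have : CompactSpace {A : Matrix (Fin p ⊕ Fin q) (Fin p ⊕ Fin q) ℝ //
      A.det = 1 ∧ ∀ i j, |A i j| ≤ R} := isCompact_iff_compactSpace.1
    (isCompact_unimodular_bounded R)
  refine (isCompact_range hc).of_isClosed_subset ?_ fun g hg =>
    ⟨⟨slMat p q g, det_slMat g, hg⟩, slMat_injective rfl⟩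
  exact (isClosed_entries_le R).preimage continuous_slMat

lemma congr_inv_mul {J : Matrix (Fin p ⊕ Fin q) (Fin p ⊕ Fin q) ℝ} {g h : ↥(SLpq p q)}
    (heq : slMat p q g * J * (slMat p q g)ᵀ = slMat p q h * J * (slMat p q h)ᵀ) :
    slMat p q (h⁻¹ * g) * J * (slMat p q (h⁻¹ * g))ᵀ = J := by
  have h1 : slMat p q h⁻¹ * slMat p q h = 1 := by rw [← map_mul, inv_mul_cancel, map_one]
  calc slMat p q (h⁻¹ * g) * J * (slMat p q (h⁻¹ * g))ᵀ
      = slMat p q h⁻¹ * (slMat p q g * J * (slMat p q g)ᵀ) * (slMat p q h⁻¹)ᵀ := by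
        rw [map_mul, transpose_mul]; simp only [Matrix.mul_assoc]
    _ = (slMat p q h⁻¹ * slMat p q h) * J * (slMat p q h⁻¹ * slMat p q h)ᵀ := by
        rw [heq, transpose_mul]; simp only [Matrix.mul_assoc]
    _ = J := by rw [h1, transpose_one, one_mul, mul_one]

lemma inv_mul_mem_slBall_one {g h : ↥(SLpq p q)}
    (heq : slMat p q g * (diagonal fun _ => 1) * (slMat p q g)ᵀ =
      slMat p q h * (diagonal fun _ => 1) * (slMat p q h)ᵀ) : h⁻¹ * g ∈ slBall p q 1 := by
  have h1 := congr_inv_mul heq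
  rw [diagonal_one, mul_one] at h1
  intro i j
  refine entry_norm_bound_of_unitary (𝕜 := ℝ) (mem_unitaryGroup_iff.2 ?_) i j
  rwa [star_eq_conjTranspose, conjTranspose_eq_transpose_of_trivial]

lemma signature_mul_self (i : Fin p ⊕ Fin q) :
    (Sum.elim (fun _ => 1) (fun _ => -1) : Fin p ⊕ Fin q → ℝ) i *
      (Sum.elim (fun _ => 1) (fun _ => -1) : Fin p ⊕ Fin q → ℝ) i = 1 := by
  cases i <;> simp

lemma mk_eq_mk_of_congr {g h : ↥(SLpq p q)}
    (heq : slMat p q g * Jpq p q * (slMat p q g)ᵀ = slMat p q h * Jpq p q * (slMat p q h)ᵀ) :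
    (g : ↥(SLpq p q) ⧸ SOpqInSL p q) = h :=
  (QuotientGroup.eq.2 (transpose_mul_diagonal_mul signature_mul_self (congr_inv_mul heq))).symm

lemma congr_of_mk_eq_mk {g h : ↥(SLpq p q)} (heq : (g : ↥(SLpq p q) ⧸ SOpqInSL p q) = h) :
    slMat p q g * Jpq p q * (slMat p q g)ᵀ = slMat p q h * Jpq p q * (slMat p q h)ᵀ := by
  have h1 : (slMat p q (h⁻¹ * g))ᵀ * Jpq p q * slMat p q (h⁻¹ * g) = Jpq p q :=
    QuotientGroup.eq.1 heq.symm
  have h2 : slMat p q (h⁻¹ * g) * Jpq p q * (slMat p q (h⁻¹ * g))ᵀ = Jpq p q := by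
    have := transpose_mul_diagonal_mul (u := (slMat p q (h⁻¹ * g))ᵀ) signature_mul_self
      (by rw [transpose_transpose]; exact h1)
    rwa [transpose_transpose] at this
  have h3 : slMat p q g = slMat p q h * slMat p q (h⁻¹ * g) := by
    rw [← map_mul, mul_inv_cancel_left]
  rw [h3, transpose_mul]
  nth_rewrite 2 [← h2]
  simp only [Matrix.mul_assoc]

variable (Γ : Subgroup ↥(SLpq p q))

/-- The tautological representation of a subgroup of the special linear group. -/
def subMat : ↥Γ →* Matrix (Fin p ⊕ Fin q) (Fin p ⊕ Fin q) ℝ := (slMat p q).comp Γ.subtype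

lemma det_subMat (γ : ↥Γ) : (subMat Γ γ).det = 1 := det_slMat _

lemma properOn_indefinite [Nonempty (Fin p ⊕ Fin q)]
    [ProperlyDiscontinuousSMul ↥Γ (↥(SLpq p q) ⧸ SOpqInSL p q)] :
    ProperOn (dilRep (subMat Γ)) (symCone (Jpq p q)) := by
  refine properOn_symCone (det_subMat Γ) signature_mul_self fun R => ?_
  have hK : IsCompact ((fun g : ↥(SLpq p q) => (g : ↥(SLpq p q) ⧸ SOpqInSL p q)) ''
      slBall p q R) := (isCompact_slBall R).image QuotientGroup.continuous_mk
  refine (ProperlyDiscontinuousSMul.finite_disjoint_inter_image (Γ := ↥Γ) hK hK).subset ?_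
  rintro γ ⟨g, h, hg, hh, hgR, hhR, heq⟩
  refine ⟨(slOf h hh : ↥(SLpq p q) ⧸ SOpqInSL p q), ⟨_, ⟨slOf g hg, hgR, rfl⟩, ?_⟩,
    slOf h hh, hhR, rfl⟩
  exact mk_eq_mk_of_congr (g := (γ : ↥(SLpq p q)) * slOf g hg) (h := slOf h hh) heq

lemma properOn_definite [Nonempty (Fin p ⊕ Fin q)] [DiscreteTopology ↥Γ] :
    ProperOn (dilRep (subMat Γ)) (symCone (diagonal fun _ => 1)) := by
  refine properOn_symCone (det_subMat Γ) (fun _ => one_mul 1) fun R => ?_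
  have hS : IsCompact (slBall p q R * slBall p q 1 * (slBall p q R)⁻¹) :=
    ((isCompact_slBall R).mul (isCompact_slBall 1)).mul (isCompact_slBall R).inv
  have hcl : IsClosed (Γ : Set ↥(SLpq p q)) := Subgroup.isClosed_of_discrete
  have hfin := (hcl.isClosedEmbedding_subtypeVal.isCompact_preimage hS).finite_of_discrete
  refine hfin.subset ?_
  rintro γ ⟨g, h, hg, hh, hgR, hhR, heq⟩
  have h1 := inv_mul_mem_slBall_one (g := (γ : ↥(SLpq p q)) * slOf g hg) (h := slOf h hh) heq
  refine Set.mem_mul.2 ⟨(γ : ↥(SLpq p q)) * slOf g hg, Set.mem_mul.2 ⟨slOf h hh, hhR, _, h1, ?_⟩,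
    (slOf g hg)⁻¹, Set.inv_mem_inv.2 hgR, ?_⟩
  · rw [mul_inv_cancel_left]
  · rw [mul_inv_cancel_right]

end SpecialLinear

section Boost

variable {m : Type*} [Fintype m] [DecidableEq m]

/-- The hyperbolic rotation with parameters `c`, `s` in the coordinate plane of `e` and `f`. -/
def boost (e f : m) (c s : ℝ) : Matrix m m ℝ :=
  1 + (c - 1) • (single e e 1 + single f f 1) + s • (single e f 1 + single f e 1)

omit [Fintype m] in
lemma transpose_boost (e f : m) (c s : ℝ) : (boost e f c s)ᵀ = boost e f c s := by
  simp [boost, add_comm]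

lemma boost_mul_boost {e f : m} (hef : e ≠ f) (c s c' s' : ℝ) :
    boost e f c s * boost e f c' s' = boost e f (c * c' + s * s') (c * s' + s * c') := by
  simp only [boost, mul_add, add_mul, mul_one, one_mul, smul_mul_smul_comm,
    single_mul_single_same, single_mul_single_of_ne _ _ _ _ hef, smul_add,
    single_mul_single_of_ne _ _ _ _ hef.symm, smul_zero, add_zero, zero_add]
  module

omit [Fintype m] in
lemma boost_one_zero (e f : m) : boost e f 1 0 = 1 := by simp [boost]

omit [Fintype m] in
lemma boost_apply {e f : m} (hef : e ≠ f) (c s : ℝ) : boost e f c s e f = s := by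
  simp [boost, hef, hef.symm]

lemma diagonal_mul_boost {e f : m} {w : m → ℝ} (he : w e = 1) (hf : w f = -1) (c s : ℝ) :
    diagonal w * boost e f c s = boost e f c (-s) * diagonal w := by
  ext i j
  simp only [boost, diagonal_mul, mul_diagonal, Matrix.add_apply, Matrix.smul_apply, single_apply,
    one_apply, smul_eq_mul]
  grind

lemma boost_congr {e f : m} (hef : e ≠ f) {w : m → ℝ} (he : w e = 1) (hf : w f = -1) {c s : ℝ}
    (hcs : c * c - s * s = 1) : boost e f c s * diagonal w * (boost e f c s)ᵀ = diagonal w := by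
  rw [transpose_boost, Matrix.mul_assoc, diagonal_mul_boost he hf, ← Matrix.mul_assoc,
    boost_mul_boost hef, show c * c + s * -s = 1 by linarith, show c * -s + s * c = 0 by ring,
    boost_one_zero, one_mul]

lemma det_boost {e f : m} (hef : e ≠ f) {c s : ℝ} (hc : 1 ≤ c) (hcs : c * c - s * s = 1) :
    (boost e f c s).det = 1 := by
  set a := √((c + 1) / 2) with ha
  set b := s / (2 * a) with hb
  have ha2 : a * a = (c + 1) / 2 := Real.mul_self_sqrt (by linarith)
  have ha0 : a ≠ 0 := fun h => by rw [h] at ha2; linarith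
  have hb2 : b * b = (c - 1) / 2 := by
    rw [hb, div_mul_div_comm, mul_mul_mul_comm, ha2]
    field_simp
    linear_combination -hcs
  have hab : a * b = s / 2 := by rw [hb]; field_simp
  have hsq : boost e f c s = boost e f a b * boost e f a b := by
    rw [boost_mul_boost hef, ha2, hb2, mul_comm b a, hab]
    congr 1 <;> ring
  have hinv : boost e f a b * boost e f a (-b) = 1 := by
    rw [boost_mul_boost hef, ← boost_one_zero e f]
    congr 1
    · linear_combination ha2 - hb2
    · ring
  set w : m → ℝ := fun i => if i = f then -1 else 1 with hw
  have hwd : (diagonal w).det ≠ 0 := by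
    rw [det_diagonal]
    exact Finset.prod_ne_zero_iff.2 fun i _ => by rw [hw]; dsimp only; split_ifs <;> norm_num
  have hdet : (boost e f a b).det = (boost e f a (-b)).det := by
    have h := congrArg det (diagonal_mul_boost (w := w) (if_neg hef) (if_pos rfl) a b)
    rw [det_mul, det_mul, mul_comm] at h
    exact mul_right_cancel₀ hwd h
  have h := congrArg det hinv
  rwa [det_mul, ← hdet, ← det_mul, ← hsq, det_one] at h

end Boost

section SpecialLinearCone

open Topology Pointwise

variable {p q : ℕ} (Γ : Subgroup ↥(SLpq p q))

lemma exists_large_mem_indefinite (e : Fin p) (f : Fin q) (B : ℝ) : ∃ h : ↥(SLpq p q),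
    slMat p q h * Jpq p q * (slMat p q h)ᵀ = Jpq p q ∧ B < |slMat p q h (.inl e) (.inr f)| := by
  have hef : (Sum.inl e : Fin p ⊕ Fin q) ≠ Sum.inr f := Sum.inl_ne_inr
  set s : ℝ := |B| + 1 with hs
  set c : ℝ := √(1 + s * s) with hc
  have hc2 : c * c = 1 + s * s := Real.mul_self_sqrt (by positivity)
  have hc1 : 1 ≤ c := Real.one_le_sqrt.2 (by nlinarith [mul_self_nonneg s])
  have hcs : c * c - s * s = 1 := by linarith
  refine ⟨slOf (boost (.inl e) (.inr f) c s) (det_boost hef hc1 hcs),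
    boost_congr hef rfl rfl hcs, ?_⟩
  rw [slMat_slOf, boost_apply hef, hs, abs_of_pos (by positivity)]
  linarith [le_abs_self B]

lemma not_cocompact_definite (e : Fin p) (f : Fin q)
    [ProperlyDiscontinuousSMul ↥Γ (↥(SLpq p q) ⧸ SOpqInSL p q)] {K : Set (Sym2 (Fin p ⊕ Fin q) → ℝ)}
    (hK1 : K ⊆ symCone (diagonal fun _ => 1)) (hK : IsCompact K) :
    ∃ y ∈ symCone (diagonal fun _ : Fin p ⊕ Fin q => (1 : ℝ)),
      ∀ l, dilRep (subMat Γ) l *ᵥ y ∉ K := by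
  by_contra! hall
  have : Nonempty (Fin p ⊕ Fin q) := ⟨.inl e⟩
  obtain ⟨R, hR⟩ := exists_congr_of_return (det_subMat Γ) (fun _ => one_mul 1) hK hK1
  set L := slBall p q R * slBall p q 1 with hL
  have hLc : IsCompact L := (isCompact_slBall R).mul (isCompact_slBall 1)
  have hLq : IsCompact ((fun g : ↥(SLpq p q) => (g : ↥(SLpq p q) ⧸ SOpqInSL p q)) '' L) :=
    hLc.image QuotientGroup.continuous_mk
  have hfin := ProperlyDiscontinuousSMul.finite_disjoint_inter_image (Γ := ↥Γ)
    (isCompact_singleton (x := ((1 : ↥(SLpq p q)) : ↥(SLpq p q) ⧸ SOpqInSL p q))) hLq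
  have hT := hfin.isCompact_biUnion fun γ _ =>
    hLc.image (continuous_const_mul (γ : ↥(SLpq p q))⁻¹)
  obtain ⟨B, hB⟩ := hT.exists_bound_of_continuousOn
    (continuous_slMat.matrix_elem (.inl e) (.inr f)).continuousOn
  obtain ⟨h, hh, hhB⟩ := exists_large_mem_indefinite e f B
  refine hhB.not_ge (hB h ?_)
  have hsym : (slMat p q h * (diagonal fun _ => 1) * (slMat p q h)ᵀ)ᵀ =
      slMat p q h * (diagonal fun _ => 1) * (slMat p q h)ᵀ :=
    transpose_congr (diagonal_transpose _) _
  obtain ⟨⟨γ, k⟩, hγ⟩ := hall (ofSym (slMat p q h * (diagonal fun _ => 1) * (slMat p q h)ᵀ))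
    ⟨slMat p q h, by rw [det_slMat]; exact one_ne_zero, toSym_ofSym hsym⟩
  obtain ⟨g, hg, hgR, hgeq⟩ := hR _ _ hγ (slMat p q h) 1 one_pos (det_slMat h)
    (by rw [toSym_ofSym hsym, one_smul])
  have h1 := inv_mul_mem_slBall_one (g := (γ : ↥(SLpq p q)) * h) (h := slOf g hg) hgeq
  have h2 : (γ : ↥(SLpq p q)) * h ∈ L :=
    Set.mem_mul.2 ⟨slOf g hg, hgR, _, h1, mul_inv_cancel_left _ _⟩
  have h3 : (((γ : ↥(SLpq p q)) * h : ↥(SLpq p q)) : ↥(SLpq p q) ⧸ SOpqInSL p q) =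
      ((γ * 1 : ↥(SLpq p q)) : ↥(SLpq p q) ⧸ SOpqInSL p q) := by
    refine mk_eq_mk_of_congr ?_
    rw [map_mul, mul_one, transpose_mul]
    nth_rewrite 2 [← hh]
    simp only [Matrix.mul_assoc]
  refine Set.mem_biUnion (x := γ) ⟨_, ⟨_, rfl, rfl⟩, ⟨_, h2, h3⟩⟩ ⟨_, h2, inv_mul_cancel_left _ _⟩

lemma exists_bounded_orbit_representative
    [CompactSpace (MulAction.orbitRel.Quotient ↥Γ (↥(SLpq p q) ⧸ SOpqInSL p q))] :
    ∃ R : ℝ, ∀ g : ↥(SLpq p q), ∃ γ : ↥Γ, ∃ h ∈ slBall p q R,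
      subMat Γ γ * slMat p q g * Jpq p q * (subMat Γ γ * slMat p q g)ᵀ =
        slMat p q h * Jpq p q * (slMat p q h)ᵀ := by
  let π : ↥(SLpq p q) → MulAction.orbitRel.Quotient ↥Γ (↥(SLpq p q) ⧸ SOpqInSL p q) :=
    fun g => Quotient.mk _ (g : ↥(SLpq p q) ⧸ SOpqInSL p q)
  have : ContinuousConstSMul ↥Γ (↥(SLpq p q) ⧸ SOpqInSL p q) :=
    ⟨fun γ => continuous_const_smul (γ : ↥(SLpq p q))⟩
  have hπ : IsOpenMap π :=
    (isOpenMap_quotient_mk'_mul (Γ := ↥Γ)).comp QuotientGroup.isOpenMap_coe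
  let U : ℕ → Set ↥(SLpq p q) := fun n => {g | ∀ i j, |slMat p q g i j| < n}
  have hU : ∀ n, IsOpen (U n) := fun n => by
    simp only [U, Set.ofPred_forall]
    exact isOpen_iInter_of_finite fun i => isOpen_iInter_of_finite fun j =>
      isOpen_lt (continuous_slMat.matrix_elem i j).abs continuous_const
  have hmono : Monotone fun n => π '' U n := fun a b hab => Set.image_mono fun g hg i j =>
    (hg i j).trans_le (Nat.cast_le.2 hab)
  obtain ⟨n, hn⟩ := isCompact_univ.elim_directed_cover (fun n => π '' U n)
    (fun n => hπ _ (hU n)) (fun x _ => by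
      induction x using Quotient.inductionOn with | _ x
      induction x using QuotientGroup.induction_on with | _ g
      obtain ⟨n, hn⟩ := exists_nat_gt (∑ i, ∑ j, |slMat p q g i j|)
      refine Set.mem_iUnion.2 ⟨n, g, fun i j => lt_of_le_of_lt ?_ hn, rfl⟩
      exact (Finset.single_le_sum (f := fun j => |slMat p q g i j|) (fun _ _ => abs_nonneg _)
        (Finset.mem_univ j)).trans (Finset.single_le_sum (f := fun i => ∑ j, |slMat p q g i j|)
          (fun _ _ => Finset.sum_nonneg fun _ _ => abs_nonneg _) (Finset.mem_univ i)))
    hmono.directed_le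
  refine ⟨n, fun g => ?_⟩
  obtain ⟨h, hh, hhg⟩ := hn (Set.mem_univ (π g))
  obtain ⟨γ, hγ⟩ := MulAction.orbitRel_apply.1 (Quotient.exact hhg)
  exact ⟨γ, h, fun i j => (hh i j).le, congr_of_mk_eq_mk (g := (γ : ↥(SLpq p q)) * g) hγ⟩

lemma exists_compact_covering [Nonempty (Fin p ⊕ Fin q)]
    [CompactSpace (MulAction.orbitRel.Quotient ↥Γ (↥(SLpq p q) ⧸ SOpqInSL p q))] :
    ∃ D ⊆ symCone (Jpq p q), IsCompact D ∧
      ∀ x ∈ symCone (Jpq p q), ∃ l, dilRep (subMat Γ) l *ᵥ x ∈ D := by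
  obtain ⟨R, hR⟩ := exists_bounded_orbit_representative Γ
  have hJ : (Jpq p q)ᵀ = Jpq p q := diagonal_transpose _
  refine ⟨(fun z : ℝ × Matrix (Fin p ⊕ Fin q) (Fin p ⊕ Fin q) ℝ =>
    z.1 • ofSym (z.2 * Jpq p q * z.2ᵀ)) '' (Set.Icc 1 2 ×ˢ {A | A.det = 1 ∧ ∀ i j, |A i j| ≤ R}),
    ?_, (isCompact_Icc.prod (isCompact_unimodular_bounded R)).image ?_, fun x hx => ?_⟩
  · rintro _ ⟨⟨r, A⟩, ⟨hr, hA, -⟩, rfl⟩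
    exact smul_mem_symCone (zero_lt_one.trans_le hr.1)
      ⟨A, by rw [hA]; exact one_ne_zero, toSym_ofSym (transpose_congr hJ A)⟩
  · refine continuous_fst.smul ((LinearMap.continuous_of_finiteDimensional _).comp ?_)
    exact (continuous_snd.matrix_mul continuous_const).matrix_mul continuous_snd.matrix_transpose
  · obtain ⟨_, hlift⟩ := exists_unimodular_lift signature_mul_self (isCompact_singleton (x := x))
      (Set.singleton_subset_iff.2 hx)
    obtain ⟨g, a, ha, hg, -, hgx⟩ := hlift x rfl
    obtain ⟨γ, h, hhR, hγ⟩ := hR (slOf g hg)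
    obtain ⟨k, hk⟩ := exists_mem_Ico_zpow ha (one_lt_two (α := ℝ))
    have h2k : (0 : ℝ) < 2 ^ k := zpow_pos two_pos k
    have hpow : (2 : ℝ) ^ (-k) * a = a / 2 ^ k := by
      rw [_root_.zpow_neg, div_eq_inv_mul]
    refine ⟨(γ, .ofAdd (-k)), ((2 : ℝ) ^ (-k) * a, slMat p q h), ⟨?_, det_slMat h, hhR⟩,
      toSym_injective ?_⟩
    · rw [hpow]
      refine ⟨(one_le_div h2k).2 hk.1, (div_le_iff₀ h2k).2 ?_⟩
      rw [mul_comm, ← zpow_add_one₀ two_ne_zero]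
      exact hk.2.le
    · change ((2 : ℝ) ^ (-k) * a) • toSym (ofSym _) = _
      rw [toSym_ofSym (transpose_congr hJ _), ← hγ, toSym_dilRep_mulVec, hgx, mul_smul_comm,
        smul_mul_assoc, smul_smul, transpose_mul]
      simp only [Matrix.mul_assoc]
      rfl

end SpecialLinearCone

/-- **No compact Clifford–Klein forms for `SL(p+q,ℝ)/SO(p,q)`, `p, q > 1`.**
There is no discrete subgroup `Γ` of `G = SL(p+q,ℝ)` acting properly discontinuously and
cocompactly on the homogeneous space `G/H`, where `H = SO(p,q)`. -/
theorem no_compact_CliffordKlein_form_SL_SOpq (p q : ℕ) (hp : 1 < p) (hq : 1 < q) :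
    ¬ ∃ Γ : Subgroup ↥(SLpq p q), DiscreteTopology ↥Γ ∧
      ProperlyDiscontinuousSMul ↥Γ (↥(SLpq p q) ⧸ SOpqInSL p q) ∧
      CompactSpace (MulAction.orbitRel.Quotient ↥Γ (↥(SLpq p q) ⧸ SOpqInSL p q)) := by
  rintro ⟨Γ, _, _, _⟩
  let e : Fin p := ⟨0, by omega⟩
  let f : Fin q := ⟨0, by omega⟩
  have : Nontrivial (Fin p ⊕ Fin q) := ⟨.inl e, .inr f, Sum.inl_ne_inr⟩
  have hJ : (Jpq p q).det ≠ 0 := by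
    rw [Jpq, det_diagonal]
    exact Finset.prod_ne_zero_iff.2 fun i _ => by cases i <;> simp
  have h1 : (diagonal fun _ : Fin p ⊕ Fin q => (1 : ℝ)).det ≠ 0 := by simp
  obtain ⟨D, hDC, hD, hcov⟩ := exists_compact_covering Γ
  refine no_cocompact_of_nondegenerate (relInvariant_det (det_subMat Γ)) (properOn_indefinite Γ)
    (properOn_definite Γ) (fun x hx y hy => add_mem_symCone_one hx hy)
    (fun r hr x hx => smul_mem_symCone hr hx) (fun x hx => det_toSym_ne_zero hJ hx)
    (fun x hx => det_toSym_ne_zero h1 hx)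
    (fun x hx y hy t => det_toSym_segment_ne_zero (det_toSym_ne_zero hJ hx)
      (posDef_toSym_iff.2 hy) t) (s := (1, .ofAdd 1)) ?_
    (fun K hK1 hK => not_cocompact_definite Γ e f hK1 hK) ?_ hD hDC hcov
  · change (2 : ℝ) ^ (1 : ℤ) • symRep (subMat Γ 1) = _
    rw [map_one, map_one, _root_.zpow_one]
  · exact ⟨ofSym (Jpq p q), 1, by simp, by
      rw [toSym_ofSym (A := Jpq p q) (diagonal_transpose _), one_mul, transpose_one, mul_one]⟩
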